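/- Let k ≥ 1, let X ∈ FIN_k^[∞], let F be a front on [∅, X], and let f : F → ℕ be any coloring. Then there exists Y_0 ≤ X such that f restricted to F↾Y_0 is canonical: there is a map φ such that for every (t_0,…,t_{d−1}) ∈ F↾Y_0, φ(t_0,…,t_{d−1}) is contained coordinatewise (as sets of ordered pairs) in a tuple (T^{i_0}t_{i_0}+⋯+T^{i_l}t_{i_l}, …, T^{j_0}t_{j_0}+⋯+T^{j_m}t_{j_m}) of elements of ⟨X⟩ with {i_0,…,i_l,…,j_0,…,j_m} ⊆ {0,…,d−1} and each t_i (i < d) appearing in at most one of the combinations, and such that for all s, t ∈ F↾Y_0 one has f(s) = f(t) if and only if φ(s) = φ(t). -/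

import Mathlib

open scoped Classical

/-- `x` is a `k`-vector: values `≤ k`, finite support, attains the value `k`. -/
def IsFin (k : ℕ) (x : ℕ → ℕ) : Prop :=
  (∀ n, x n ≤ k) ∧ {n | x n ≠ 0}.Finite ∧ ∃ n, x n = k

/-- `x < y` as blocks: every point of the support of `x` lies below every
point of the support of `y`. -/
def VecLt (x y : ℕ → ℕ) : Prop := ∀ m n, x m ≠ 0 → y n ≠ 0 → m < n

/-- An infinite block sequence of `k`-vectors. -/
def IsBlockSeq (k : ℕ) (X : ℕ → ℕ → ℕ) : Prop :=
  (∀ n, IsFin k (X n)) ∧ ∀ n, VecLt (X n) (X (n + 1))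

/-- `T^i x (n) = max (x n - i) 0` (truncated subtraction on `ℕ`). -/
def Tmap (i : ℕ) (x : ℕ → ℕ) : ℕ → ℕ := fun n => x n - i

/-- `w` lies in the combinatorial subspace generated by the terms `X n`, `n ∈ I`:
it is a sum `T^{e n₀} x_{n₀} + ⋯ + T^{e nₘ} x_{nₘ}` with all `e n ≤ k` and at
least one `e n = 0`. -/
def InSubspaceOn (k : ℕ) (X : ℕ → ℕ → ℕ) (I : Set ℕ) (w : ℕ → ℕ) : Prop :=
  ∃ (s : Finset ℕ) (e : ℕ → ℕ), ↑s ⊆ I ∧ s.Nonempty ∧ (∀ n ∈ s, e n ≤ k) ∧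
    (∃ n ∈ s, e n = 0) ∧ w = fun m => ∑ n ∈ s, Tmap (e n) (X n) m

/-- `w ∈ ⟨X⟩`. -/
def InSubspace (k : ℕ) (X : ℕ → ℕ → ℕ) (w : ℕ → ℕ) : Prop :=
  InSubspaceOn k X Set.univ w

/-- `Y ≤ X` : `Y` is a block sequence all of whose terms lie in `⟨X⟩`. -/
def BlockLE (k : ℕ) (Y X : ℕ → ℕ → ℕ) : Prop :=
  IsBlockSeq k Y ∧ ∀ n, InSubspace k X (Y n)

/-- `r_n(X)`, the first `n` terms of `X`, as a list. -/
def restrictN (X : ℕ → ℕ → ℕ) (n : ℕ) : List (ℕ → ℕ) := (List.range n).map X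

/-- `𝒜X_n = { r_n(Y) : Y ≤ X }`. -/
def ApproxN (k : ℕ) (X : ℕ → ℕ → ℕ) (n : ℕ) : Set (List (ℕ → ℕ)) :=
  {s | ∃ Y, BlockLE k Y X ∧ s = restrictN Y n}

/-- `𝒜X = ⋃ n, 𝒜X_n`. -/
def Approx (k : ℕ) (X : ℕ → ℕ → ℕ) : Set (List (ℕ → ℕ)) :=
  ⋃ n, ApproxN k X n

/-- `F` is a front on `[∅, X]`. -/
def IsFront (k : ℕ) (X : ℕ → ℕ → ℕ) (F : Set (List (ℕ → ℕ))) : Prop :=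
  F ⊆ Approx k X ∧ (∀ Y, BlockLE k Y X → ∃ n, restrictN Y n ∈ F) ∧
    ∀ s ∈ F, ∀ t ∈ F, s <+: t → s = t

/-- `F̂` : the set of initial segments of members of `F`. -/
def FrontHat (F : Set (List (ℕ → ℕ))) : Set (List (ℕ → ℕ)) :=
  {t | ∃ s ∈ F, t <+: s}

/-- `x` lies beyond (the supports of) all terms of the finite block sequence `s`. -/
def AfterList (s : List (ℕ → ℕ)) (x : ℕ → ℕ) : Prop := ∀ y ∈ s, VecLt y x

/-- `X` separates `s` and `t` (with respect to the coloring `f` of the front `F`):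
whenever `s⌢w, t⌢v ∈ F↾X` with `w` from `⟨X/s⟩` and `v` from `⟨X/t⟩`,
the `f`-colors differ. -/
def Separates {α : Type*} (k : ℕ) (f : List (ℕ → ℕ) → α) (F : Set (List (ℕ → ℕ)))
    (X : ℕ → ℕ → ℕ) (s t : List (ℕ → ℕ)) : Prop :=
  ∀ w v : List (ℕ → ℕ),
    (∀ x ∈ w, InSubspace k X x ∧ AfterList s x) →
    (∀ x ∈ v, InSubspace k X x ∧ AfterList t x) →
    s ++ w ∈ F → s ++ w ∈ Approx k X →
    t ++ v ∈ F → t ++ v ∈ Approx k X →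
    f (s ++ w) ≠ f (t ++ v)

/-- `X` mixes `s` with `t` : no `Y ≤ X` separates `s` and `t`. -/
def Mixes {α : Type*} (k : ℕ) (f : List (ℕ → ℕ) → α) (F : Set (List (ℕ → ℕ)))
    (X : ℕ → ℕ → ℕ) (s t : List (ℕ → ℕ)) : Prop :=
  ∀ Y, BlockLE k Y X → ¬ Separates k f F Y s t

/-- `depth_X(s)` : the least `n` with `s ≤ r_n(X)` (`∞` if none exists); this least
`n` is exactly the unique `n` with `s ≤_fin r_n(X)`. -/
noncomputable def depth (k : ℕ) (X : ℕ → ℕ → ℕ) (s : List (ℕ → ℕ)) : ℕ∞ :=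
  sInf {m : ℕ∞ | ∃ n : ℕ, m = (n : ℕ∞) ∧ ∀ x ∈ s, InSubspaceOn k X (Set.Iio n) x}

/-- `min_i w` : the least point where `w` takes the value `i` (junk value if none). -/
noncomputable def minIdx (i : ℕ) (w : ℕ → ℕ) : ℕ := sInf {n | w n = i}

/-- `max_i w` : the largest point where `w` takes the value `i` (junk value if none). -/
noncomputable def maxIdx (i : ℕ) (w : ℕ → ℕ) : ℕ := sSup {n | w n = i}

/-- The vector with value `i` at `min_i w` and `0` elsewhere. -/
noncomputable def minVec (i : ℕ) (w : ℕ → ℕ) : ℕ → ℕ :=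
  fun n => if n = minIdx i w then i else 0

/-- The vector with value `i` at `max_i w` and `0` elsewhere. -/
noncomputable def maxVec (i : ℕ) (w : ℕ → ℕ) : ℕ → ℕ :=
  fun n => if n = maxIdx i w then i else 0

/-- `θ⁰_{i,l}(w) = {(n,l) : n ∈ (min_i w, min_{i+1} w), w n = l}`. -/
noncomputable def theta0 (i l : ℕ) (w : ℕ → ℕ) : ℕ → ℕ :=
  fun n => if minIdx i w < n ∧ n < minIdx (i + 1) w ∧ w n = l then l else 0

/-- `θ¹_{i,l}(w) = {(n,l) : n ∈ (max_{i+1} w, max_i w), w n = l}`. -/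
noncomputable def theta1 (i l : ℕ) (w : ℕ → ℕ) : ℕ → ℕ :=
  fun n => if maxIdx (i + 1) w < n ∧ n < maxIdx i w ∧ w n = l then l else 0

/-- `θ²_l(w) = {(n,l) : n ∈ (min_k w, max_k w), w n = l}`. -/
noncomputable def theta2 (k l : ℕ) (w : ℕ → ℕ) : ℕ → ℕ :=
  fun n => if minIdx k w < n ∧ n < maxIdx k w ∧ w n = l then l else 0

def Gmin (k : ℕ) : Set ((ℕ → ℕ) → ℕ → ℕ) := {g | ∃ i, 1 ≤ i ∧ i ≤ k ∧ g = minVec i}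
def Gmax (k : ℕ) : Set ((ℕ → ℕ) → ℕ → ℕ) := {g | ∃ i, 1 ≤ i ∧ i ≤ k ∧ g = maxVec i}
def Gmid0 (k : ℕ) : Set ((ℕ → ℕ) → ℕ → ℕ) :=
  {g | ∃ i l, 1 ≤ i ∧ i ≤ k - 1 ∧ 1 ≤ l ∧ l ≤ i - 1 ∧ g = theta0 i l}
def Gmid1 (k : ℕ) : Set ((ℕ → ℕ) → ℕ → ℕ) :=
  {g | ∃ i l, 1 ≤ i ∧ i ≤ k - 1 ∧ 1 ≤ l ∧ l ≤ i - 1 ∧ g = theta1 i l}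
def Gmid (k : ℕ) : Set ((ℕ → ℕ) → ℕ → ℕ) :=
  {g | (∃ l, 1 ≤ l ∧ l ≤ k ∧ g = theta2 k l) ∨ g = fun _ _ => 0}

/-- The family `𝒢` of elementary staircase maps. -/
def Gfam (k : ℕ) : Set ((ℕ → ℕ) → ℕ → ℕ) :=
  Gmin k ∪ Gmax k ∪ Gmid0 k ∪ Gmid1 k ∪ Gmid k

/-- A staircase function : a member of the lattice closure of `𝒢` under the
pointwise join `(f ∨ g)(w) = f(w) ∨ g(w)`. -/
inductive IsStaircase (k : ℕ) : ((ℕ → ℕ) → ℕ → ℕ) → Prop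
  | base (g : (ℕ → ℕ) → ℕ → ℕ) (hg : g ∈ Gfam k) : IsStaircase k g
  | join (f g : (ℕ → ℕ) → ℕ → ℕ) (hf : IsStaircase k f) (hg : IsStaircase k g) :
      IsStaircase k (fun w n => max (f w n) (g w n))

/-- `x` is a system of staircases (sos). -/
def IsSos (k : ℕ) (x : ℕ → ℕ) : Prop :=
  IsFin k x ∧ Set.range x = Set.Iic k ∧
  (∀ i j, 1 ≤ i → i < j → j ≤ k → minIdx i x < minIdx j x ∧ minIdx j x < maxIdx i x) ∧
  ∀ i, 1 ≤ i → i ≤ k →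
    x '' Set.Ico (minIdx (i - 1) x) (minIdx i x) = Set.Iic (i - 1) ∧
    x '' Set.Ioc (maxIdx i x) (maxIdx (i - 1) x) = Set.Iic (i - 1) ∧
    x '' Set.Icc (minIdx k x) (maxIdx k x) = Set.Iic k

/-- `x ⊆ y` as sets of ordered pairs `{(n, x n) : x n ≠ 0}`. -/
def VecSub (x y : ℕ → ℕ) : Prop := ∀ n, x n ≠ 0 → x n = y n

/-- `a` is contained in `b` coordinatewise (as sets of ordered pairs), after
matching `a` with a sublist of `b` of the same length. -/
def ListInner (a b : List (ℕ → ℕ)) : Prop :=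
  ∃ b' : List (ℕ → ℕ), b'.Sublist b ∧ a.length = b'.length ∧
    ∀ i < a.length, VecSub (a.getD i (fun _ => 0)) (b'.getD i (fun _ => 0))

/-- The value `φ_s(w)` for a family of (possibly empty) maps `Φ`. -/
def phiVal (Φ : List (ℕ → ℕ) → Option ((ℕ → ℕ) → ℕ → ℕ)) (s : List (ℕ → ℕ))
    (w : ℕ → ℕ) : Option (ℕ → ℕ) :=
  (Φ s).map fun g => g w

/-- The inner map `φ(s) = ⋃_{s' ⊑ s} φ_{s'}(s(|s'|))`, the concatenation of the
values `φ_{r_i(s)}(s(i))` over those `i < |s|` with `φ_{r_i(s)} ≠ ∅`. -/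
def innerMap (Φ : List (ℕ → ℕ) → Option ((ℕ → ℕ) → ℕ → ℕ)) (s : List (ℕ → ℕ)) :
    List (ℕ → ℕ) :=
  (List.range s.length).filterMap fun i =>
    (Φ (s.take i)).map fun g => g (s.getD i (fun _ => 0))

/-- `X` weakly mixes `s` with `t`, witnessed by the vector `w` (`w = w_s^t`). -/
def WeaklyMixesWith (k : ℕ) (f : List (ℕ → ℕ) → ℕ) (F : Set (List (ℕ → ℕ)))
    (X : ℕ → ℕ → ℕ) (s t : List (ℕ → ℕ)) (w : ℕ → ℕ) : Prop :=
  depth k X s < depth k X t ∧ w ∈ t ∧ w ∉ s ∧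
  ∀ Y, BlockLE k Y X →
    (∃ Z, BlockLE k Z Y ∧ restrictN Z s.length = s) →
    (∃ Z, BlockLE k Z Y ∧ restrictN Z t.length = t) →
    ∃ sbar tbar : List (ℕ → ℕ), sbar ∈ F ∩ Approx k Y ∧ tbar ∈ F ∩ Approx k Y ∧
      t <+: tbar ∧
      (∃ v, InSubspace k Y v ∧ VecLt w v ∧ (s ++ [fun n => w n + v n]) <+: sbar) ∧
      f sbar = f tbar

/-- `c` is a tuple of combinations `T^{i_0} t_{i_0} + ⋯ + T^{i_l} t_{i_l}` of the
terms of `t`, lying in `⟨X⟩`, with pairwise disjoint sets of indices (each term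
of `t` appears in at most one combination). -/
def IsComb (k : ℕ) (X : ℕ → ℕ → ℕ) (t c : List (ℕ → ℕ)) : Prop :=
  ∃ (I : ℕ → Finset ℕ) (e : ℕ → ℕ → ℕ),
    (∀ m < c.length,
      (I m).Nonempty ∧ (∀ j ∈ I m, j < t.length) ∧ (∀ j ∈ I m, e m j ≤ k) ∧
      (∃ j ∈ I m, e m j = 0) ∧
      c.getD m (fun _ => 0) =
        (fun n => ∑ j ∈ I m, Tmap (e m j) (t.getD j (fun _ => 0)) n) ∧
      InSubspace k X (c.getD m (fun _ => 0))) ∧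
    ∀ m < c.length, ∀ m' < c.length, m ≠ m' → Disjoint (I m) (I m')

/-- The Suslin operation applied to a scheme indexed by finite sequences. -/
def SuslinOp {α : Type*} (P : List ℕ → Set α) : Set α :=
  ⋃ x : ℕ → ℕ, ⋂ n : ℕ, P ((List.range n).map x)

/-- The basic (open) sets `[s, X]` of the space `FIN_k^[∞]`. -/
def BasicOpen (k : ℕ) : Set (Set (ℕ → ℕ → ℕ)) :=
  {B | ∃ (s : List (ℕ → ℕ)) (X : ℕ → ℕ → ℕ), IsBlockSeq k X ∧ s ∈ Approx k X ∧
    B = {Y | BlockLE k Y X ∧ restrictN Y s.length = s}}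

/-- The topology on `FIN_k^[∞]` generated by the basic sets `[s, X]`. -/
def finkTop (k : ℕ) : TopologicalSpace (ℕ → ℕ → ℕ) :=
  TopologicalSpace.generateFrom (BasicOpen k)

/-- The smallest σ-field containing the closed sets and closed under the
Suslin operation. -/
inductive InSuslinField {α : Type*} (T : TopologicalSpace α) : Set α → Prop
  | closed (s : Set α) (hs : @IsClosed α T s) : InSuslinField T s
  | compl (s : Set α) (hs : InSuslinField T s) : InSuslinField T sᶜ
  | iUnion (g : ℕ → Set α) (hg : ∀ n, InSuslinField T (g n)) : InSuslinField T (⋃ n, g n)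
  | suslin (P : List ℕ → Set α) (hP : ∀ u, InSuslinField T (P u)) :
      InSuslinField T (SuslinOp P)

/-! ### Combinatorial subspaces as joins -/

/-- The truncation of a `k`-vector to a `j`-vector. -/
def raise (k j : ℕ) (x : ℕ → ℕ) : ℕ → ℕ := Tmap (k - j) x

/-- The join of the truncations of the first `N` terms of `Y` to the heights `w`. -/
def psum (k : ℕ) (Y : ℕ → ℕ → ℕ) (w : ℕ → ℕ) (N : ℕ) : ℕ → ℕ :=
  fun p => (Finset.range N).sup fun i => Y i p - (k - w i)

theorem psum_zero (k : ℕ) (Y : ℕ → ℕ → ℕ) (w : ℕ → ℕ) : psum k Y w 0 = 0 := by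
  ext p; simp [psum]

theorem psum_succ (k : ℕ) (Y : ℕ → ℕ → ℕ) (w : ℕ → ℕ) (N : ℕ) :
    psum k Y w (N + 1) = psum k Y w N ⊔ raise k (w N) (Y N) := by
  ext p
  simp [psum, Finset.range_add_one, raise, Tmap, sup_comm]

theorem psum_congr {k : ℕ} {Y : ℕ → ℕ → ℕ} {w w' : ℕ → ℕ} {N : ℕ}
    (h : ∀ i < N, w i = w' i) : psum k Y w N = psum k Y w' N := by
  ext p
  exact Finset.sup_congr rfl fun i hi => by rw [h i (Finset.mem_range.1 hi)]

theorem psum_sup (k : ℕ) (Y : ℕ → ℕ → ℕ) (w w' : ℕ → ℕ) (N : ℕ) :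
    psum k Y w N ⊔ psum k Y w' N = psum k Y (w ⊔ w') N := by
  ext p
  simp only [psum, Pi.sup_apply]
  rw [← Finset.sup_sup]
  refine Finset.sup_congr rfl fun i _ => ?_
  simp only [Pi.sup_apply]
  omega

theorem tmap_psum {k : ℕ} {Y : ℕ → ℕ → ℕ} (hY : ∀ i p, Y i p ≤ k) {w : ℕ → ℕ}
    (hw : ∀ i, w i ≤ k) (a N : ℕ) :
    Tmap a (psum k Y w N) = psum k Y (fun i => w i - a) N := by
  induction N with
  | zero => ext p; simp [psum_zero, Tmap]
  | succ N ih =>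
    rw [psum_succ, psum_succ, ← ih]
    ext p
    simp only [Tmap, raise, Pi.sup_apply]
    have := hY N p
    have := hw N
    omega

/-- The joins of truncations of finitely many terms of `X`. -/
def weakSpan (k : ℕ) (X : ℕ → ℕ → ℕ) : Set (ℕ → ℕ) :=
  {v | ∃ w N, (∀ i, w i ≤ k) ∧ v = psum k X w N}

theorem psum_extend {k : ℕ} {Y : ℕ → ℕ → ℕ} (hY : ∀ i p, Y i p ≤ k) (w : ℕ → ℕ)
    {N M : ℕ} (h : N ≤ M) :
    psum k Y w N = psum k Y (fun i => if i < N then w i else 0) M := by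
  induction M, h using Nat.le_induction with
  | base => exact psum_congr fun i hi => by simp [hi]
  | succ M hM ih =>
    rw [psum_succ, ← ih]
    ext p
    have := hY M p
    simp only [Pi.sup_apply, raise, Tmap, not_lt.2 hM, if_false]
    omega

section Span

variable {k : ℕ} {X : ℕ → ℕ → ℕ}

theorem IsBlockSeq.le (hX : IsBlockSeq k X) (i p : ℕ) : X i p ≤ k := (hX.1 i).1 p

theorem IsBlockSeq.vecLt (hk : 1 ≤ k) (hX : IsBlockSeq k X) {i j : ℕ} (h : i < j) :
    VecLt (X i) (X j) := by
  induction j, h using Nat.le_induction with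
  | base => exact hX.2 i
  | succ j _ ih =>
    intro m n hm hn
    obtain ⟨r, hr⟩ := (hX.1 j).2.2
    exact (ih m r hm (by omega)).trans (hX.2 j r n (by omega) hn)

theorem IsBlockSeq.eq_zero (hk : 1 ≤ k) (hX : IsBlockSeq k X) {i j p : ℕ} (h : i ≠ j)
    (hi : X i p ≠ 0) : X j p = 0 := by
  by_contra hj
  rcases lt_or_gt_of_ne h with h | h
  · exact lt_irrefl _ (hX.vecLt hk h p p hi hj)
  · exact lt_irrefl _ (hX.vecLt hk h p p hj hi)

theorem psum_apply_eq_zero {w : ℕ → ℕ} {N p : ℕ} (h : ∀ i < N, X i p = 0) :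
    psum k X w N p = 0 := by
  simp only [psum]
  rw [← Nat.bot_eq_zero, Finset.sup_eq_bot_iff]
  intro i hi
  simp [h i (Finset.mem_range.1 hi)]

theorem psum_apply (hk : 1 ≤ k) (hX : IsBlockSeq k X) {w : ℕ → ℕ} {N i p : ℕ} (hi : i < N)
    (hp : X i p ≠ 0) : psum k X w N p = X i p - (k - w i) := by
  refine le_antisymm (Finset.sup_le fun j _ => ?_)
    (Finset.le_sup (f := fun i => X i p - (k - w i)) (Finset.mem_range.2 hi))
  by_cases h : i = j
  · rw [h]
  · simp [hX.eq_zero hk h hp]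

theorem zero_mem_weakSpan : (0 : ℕ → ℕ) ∈ weakSpan k X :=
  ⟨0, 0, fun _ => Nat.zero_le _, (psum_zero _ _ _).symm⟩

theorem sup_mem_weakSpan (hX : IsBlockSeq k X) {u v : ℕ → ℕ} (hu : u ∈ weakSpan k X)
    (hv : v ∈ weakSpan k X) : u ⊔ v ∈ weakSpan k X := by
  obtain ⟨w, N, hw, rfl⟩ := hu
  obtain ⟨w', N', hw', rfl⟩ := hv
  rw [psum_extend hX.le w (le_max_left N N'), psum_extend hX.le w' (le_max_right N N'), psum_sup]
  refine ⟨_, _, fun i => ?_, rfl⟩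
  have := hw i
  have := hw' i
  simp only [Pi.sup_apply]
  split_ifs <;> omega

theorem tmap_mem_weakSpan (hX : IsBlockSeq k X) {u : ℕ → ℕ} (hu : u ∈ weakSpan k X) (a : ℕ) :
    Tmap a u ∈ weakSpan k X := by
  obtain ⟨w, N, hw, rfl⟩ := hu
  exact ⟨_, N, fun i => (Nat.sub_le _ _).trans (hw i), tmap_psum hX.le hw a N⟩

theorem weakSpan_le (hX : IsBlockSeq k X) {u : ℕ → ℕ} (hu : u ∈ weakSpan k X) (p : ℕ) :
    u p ≤ k := by
  obtain ⟨w, N, _, rfl⟩ := hu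
  exact Finset.sup_le fun i _ => (Nat.sub_le _ _).trans (hX.le i p)

theorem sum_eq_sup_of_subsingleton {s : Finset ℕ} {g : ℕ → ℕ}
    (h : ∀ i j, i ≠ j → g i ≠ 0 → g j = 0) : ∑ i ∈ s, g i = s.sup g := by
  by_cases h0 : ∃ i ∈ s, g i ≠ 0
  · obtain ⟨i, hi, hgi⟩ := h0
    rw [Finset.sum_eq_single_of_mem i hi fun j _ hj => h i j hj.symm hgi]
    refine le_antisymm (Finset.le_sup hi) (Finset.sup_le fun j _ => ?_)
    by_cases hij : i = j
    · rw [hij]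
    · simp [h i j hij hgi]
  · push Not at h0
    rw [Finset.sum_eq_zero h0, eq_comm, ← Nat.bot_eq_zero, Finset.sup_eq_bot_iff]
    exact h0

theorem sum_tmap_eq (hk : 1 ≤ k) (hX : IsBlockSeq k X) (s : Finset ℕ) (e : ℕ → ℕ) (p : ℕ) :
    ∑ n ∈ s, Tmap (e n) (X n) p = s.sup fun n => X n p - e n :=
  sum_eq_sup_of_subsingleton (g := fun n => X n p - e n) fun i j hij hi => by
    simp [hX.eq_zero hk hij (p := p) (fun h => hi (by simp [h]))]

theorem exists_eq_of_psum_eq (hk : 1 ≤ k) (hX : IsBlockSeq k X) {w : ℕ → ℕ} {N p : ℕ}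
    (hw : ∀ i, w i ≤ k) (hp : psum k X w N p = k) : ∃ i < N, w i = k := by
  by_contra! h
  have : psum k X w N p < k := by
    simp only [psum]
    rw [Finset.sup_lt_iff (Nat.bot_eq_zero ▸ hk)]
    intro i hi
    have := h i (Finset.mem_range.1 hi)
    have := hw i
    have := hX.le i p
    omega
  omega

theorem inSubspace_iff (hk : 1 ≤ k) (hX : IsBlockSeq k X) {v : ℕ → ℕ} :
    InSubspace k X v ↔ v ∈ weakSpan k X ∧ ∃ p, v p = k := by
  constructor
  · rintro ⟨s, e, -, -, he, ⟨n, hn, hen⟩, rfl⟩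
    obtain ⟨N, hN⟩ := s.exists_nat_subset_range
    refine ⟨⟨fun i => if i ∈ s then k - e i else 0, N, fun i => by dsimp only; split_ifs <;> omega, ?_⟩, ?_⟩
    · ext p
      rw [sum_tmap_eq hk hX]
      refine le_antisymm (Finset.sup_le fun i hi => ?_) (Finset.sup_le fun i hi => ?_)
      · refine le_trans ?_ (Finset.le_sup (f := fun i => X i p - (k - if i ∈ s then k - e i else 0))
          (hN hi))
        have := he i hi
        simp only [hi, if_true]
        omega
      · by_cases his : i ∈ s
        · refine le_trans ?_ (Finset.le_sup (f := fun n => X n p - e n) his)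
          have := he i his
          simp only [his, if_true]
          omega
        · have := hX.le i p
          simp only [his, if_false]
          omega
    · obtain ⟨p, hp⟩ := (hX.1 n).2.2
      refine ⟨p, ?_⟩
      simp only
      rw [Finset.sum_eq_single_of_mem n hn, Tmap, hen, hp, Nat.sub_zero]
      intro j _ hj
      simp [Tmap, hX.eq_zero hk hj.symm (p := p) (by omega)]
  · rintro ⟨⟨w, N, hw, rfl⟩, p, hp⟩
    obtain ⟨i, hi, hwi⟩ := exists_eq_of_psum_eq hk hX hw hp
    refine ⟨Finset.range N, fun i => k - w i, Set.subset_univ _, ⟨i, Finset.mem_range.2 hi⟩,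
      fun _ _ => Nat.sub_le _ _, ⟨i, Finset.mem_range.2 hi, by simp [hwi]⟩, ?_⟩
    ext p
    rw [sum_tmap_eq hk hX]
    rfl

theorem InSubspace.exists_psum (hk : 1 ≤ k) (hX : IsBlockSeq k X) {v : ℕ → ℕ}
    (hv : InSubspace k X v) :
    ∃ w N, (∀ i, w i ≤ k) ∧ (∃ i < N, w i = k) ∧ v = psum k X w N := by
  obtain ⟨⟨w, N, hw, rfl⟩, p, hp⟩ := (inSubspace_iff hk hX).1 hv
  exact ⟨w, N, hw, exists_eq_of_psum_eq hk hX hw hp, rfl⟩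

theorem InSubspace.isFin (hk : 1 ≤ k) (hX : IsBlockSeq k X) {v : ℕ → ℕ}
    (hv : InSubspace k X v) : IsFin k v := by
  obtain ⟨hw, hp⟩ := (inSubspace_iff hk hX).1 hv
  refine ⟨weakSpan_le hX hw, ?_, hp⟩
  obtain ⟨w, N, _, rfl⟩ := hw
  refine ((Finset.range N).finite_toSet.biUnion fun i _ => (hX.1 i).2.1).subset ?_
  intro p hp
  by_contra h
  refine hp (psum_apply_eq_zero fun i hi => ?_)
  by_contra hip
  exact h (Set.mem_biUnion (by simpa using hi) hip)

theorem inSubspace_self (n : ℕ) : InSubspace k X (X n) := by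
  refine ⟨{n}, 0, Set.subset_univ _, by simp, by simp, by simp, ?_⟩
  ext p
  simp [Tmap]

theorem weakSpan_mono (hk : 1 ≤ k) (hX : IsBlockSeq k X) {Y : ℕ → ℕ → ℕ} (hY : BlockLE k Y X) :
    weakSpan k Y ⊆ weakSpan k X := by
  rintro _ ⟨w, N, hw, rfl⟩
  induction N with
  | zero => rw [psum_zero]; exact zero_mem_weakSpan
  | succ N ih =>
    rw [psum_succ]
    exact sup_mem_weakSpan hX ih
      (tmap_mem_weakSpan hX ((inSubspace_iff hk hX).1 (hY.2 N)).1 _)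

theorem InSubspace.mono (hk : 1 ≤ k) (hX : IsBlockSeq k X) {Y : ℕ → ℕ → ℕ} (hY : BlockLE k Y X)
    {v : ℕ → ℕ} (hv : InSubspace k Y v) : InSubspace k X v := by
  rw [inSubspace_iff hk hY.1] at hv
  rw [inSubspace_iff hk hX]
  exact ⟨weakSpan_mono hk hX hY hv.1, hv.2⟩

theorem BlockLE.trans (hk : 1 ≤ k) (hX : IsBlockSeq k X) {Y Z : ℕ → ℕ → ℕ} (hZ : BlockLE k Z Y)
    (hY : BlockLE k Y X) : BlockLE k Z X :=
  ⟨hZ.1, fun n => (hZ.2 n).mono hk hX hY⟩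

theorem BlockLE.refl (hX : IsBlockSeq k X) : BlockLE k X X :=
  ⟨hX, inSubspace_self⟩

end Span

/-! ### The Gowers ultrafilter -/

/-- Functions `ℕ → ℕ` as a semigroup under the pointwise join. -/
def SupVec : Type := ℕ → ℕ

instance : Semigroup SupVec where
  mul x y := fun n => max (x n) (y n)
  mul_assoc x y z := funext fun n => max_assoc (x n) (y n) (z n)

/-- An ultrafilter of `k`-vectors of `⟨X⟩` with supports going to infinity, which absorbs
its truncations on both sides. -/
structure IsGowers (k : ℕ) (X : ℕ → ℕ → ℕ) (𝒰 : Ultrafilter (ℕ → ℕ)) : Prop where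
  mem : ∀ N, ∀ᶠ x in (𝒰 : Filter (ℕ → ℕ)), InSubspace k X x ∧ ∀ n < N, x n = 0
  left : ∀ (a : ℕ) (P : (ℕ → ℕ) → Prop), (∀ᶠ x in (𝒰 : Filter (ℕ → ℕ)), P x) ↔
    ∀ᶠ x in (𝒰 : Filter (ℕ → ℕ)), ∀ᶠ y in (𝒰 : Filter (ℕ → ℕ)), P (Tmap a x ⊔ y)
  right : ∀ (a : ℕ) (P : (ℕ → ℕ) → Prop), (∀ᶠ x in (𝒰 : Filter (ℕ → ℕ)), P x) ↔
    ∀ᶠ x in (𝒰 : Filter (ℕ → ℕ)), ∀ᶠ y in (𝒰 : Filter (ℕ → ℕ)), P (x ⊔ Tmap a y)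

section Gowers

attribute [local instance] Ultrafilter.mul Ultrafilter.semigroup

theorem continuous_ultrafilter_map {α β : Type*} (g : α → β) :
    Continuous (Ultrafilter.map g) := by
  refine continuous_generateFrom_iff.2 ?_
  rintro _ ⟨s, rfl⟩
  exact ultrafilter_isOpen_basic (g ⁻¹' s)

theorem ultrafilter_map_mul (g : SupVec → SupVec) (hg : ∀ x y, g (x * y) = g x * g y)
    (U V : Ultrafilter SupVec) : (U * V).map g = U.map g * V.map g := by
  ext s
  have h1 := Ultrafilter.eventually_mul U V (fun z => g z ∈ s)
  have h2 := Ultrafilter.eventually_mul (U.map g) (V.map g) (fun z => z ∈ s)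
  refine h1.trans (Iff.trans ?_ h2.symm)
  simp only [Ultrafilter.coe_map, Filter.eventually_map, hg]

/-- Truncation on `SupVec`. -/
def supTmap (a : ℕ) (x : SupVec) : SupVec := Tmap a x

theorem supTmap_mul (a : ℕ) (x y : SupVec) : supTmap a (x * y) = supTmap a x * supTmap a y := by
  funext n
  change max (x n) (y n) - a = max (x n - a) (y n - a)
  omega

theorem supTmap_supTmap (a b : ℕ) (x : SupVec) : supTmap a (supTmap b x) = supTmap (b + a) x := by
  funext n
  change x n - b - a = x n - (b + a)
  omega

/-- The ultrafilters of `k`-vectors of `⟨X⟩` with supports going to infinity. -/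
def cofinalUltra (k : ℕ) (X : ℕ → ℕ → ℕ) : Set (Ultrafilter SupVec) :=
  {U | ∀ N : ℕ, {x : ℕ → ℕ | InSubspace k X x ∧ ∀ n < N, x n = 0} ∈ U}

variable {k : ℕ} {X : ℕ → ℕ → ℕ}

theorem isClosed_cofinalUltra : IsClosed (cofinalUltra k X) := by
  have : cofinalUltra k X = ⋂ N : ℕ, {U : Ultrafilter SupVec |
      {x : ℕ → ℕ | InSubspace k X x ∧ ∀ n < N, x n = 0} ∈ U} := by
    ext U
    simp [cofinalUltra]
  rw [this]
  exact isClosed_iInter fun N => ultrafilter_isClosed_basic _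

theorem IsBlockSeq.eq_zero_of_lt (hk : 1 ≤ k) (hX : IsBlockSeq k X) {n p : ℕ} (h : p < n) :
    X n p = 0 := by
  induction n generalizing p with
  | zero => omega
  | succ n ih =>
    by_contra hp
    obtain ⟨r, hr⟩ := (hX.1 n).2.2
    have h1 := hX.2 n r p (by omega) hp
    have := ih (p := r) (by omega)
    omega

theorem cofinalUltra_nonempty (hk : 1 ≤ k) (hX : IsBlockSeq k X) :
    (cofinalUltra k X).Nonempty := by
  refine ⟨(Filter.hyperfilter ℕ).map X, fun N => ?_⟩
  change X ⁻¹' {x : ℕ → ℕ | InSubspace k X x ∧ ∀ n < N, x n = 0} ∈ (Filter.hyperfilter ℕ)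
  refine Filter.mem_of_superset
    (Nat.hyperfilter_le_atTop (Filter.mem_atTop N)) fun n hn => ?_
  exact ⟨inSubspace_self n, fun p hp => hX.eq_zero_of_lt hk (lt_of_lt_of_le hp hn)⟩

theorem InSubspace.sup_left (hk : 1 ≤ k) (hX : IsBlockSeq k X) {x y : ℕ → ℕ}
    (hx : x ∈ weakSpan k X) (hy : InSubspace k X y) : InSubspace k X (x ⊔ y) := by
  rw [inSubspace_iff hk hX] at hy ⊢
  refine ⟨sup_mem_weakSpan hX hx hy.1, ?_⟩
  obtain ⟨p, hp⟩ := hy.2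
  refine ⟨p, ?_⟩
  have := weakSpan_le hX hx p
  simp only [Pi.sup_apply]
  omega

theorem InSubspace.mem_weakSpan (hk : 1 ≤ k) (hX : IsBlockSeq k X) {x : ℕ → ℕ}
    (hx : InSubspace k X x) : x ∈ weakSpan k X := ((inSubspace_iff hk hX).1 hx).1

theorem map_mul_mem_cofinalUltra (hk : 1 ≤ k) (hX : IsBlockSeq k X) {U V : Ultrafilter SupVec}
    (hU : U ∈ cofinalUltra k X) (hV : V ∈ cofinalUltra k X) (a : ℕ) :
    U.map (supTmap a) * V ∈ cofinalUltra k X := by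
  intro N
  refine (Ultrafilter.eventually_mul _ V
    (fun z : SupVec => InSubspace k X z ∧ ∀ n < N, z n = 0)).2 ?_
  rw [Ultrafilter.coe_map, Filter.eventually_map]
  filter_upwards [hU N] with x hx
  filter_upwards [hV N] with y hy
  refine ⟨hy.1.sup_left hk hX (tmap_mem_weakSpan hX (hx.1.mem_weakSpan hk hX) a), fun n hn => ?_⟩
  change max (x n - a) (y n) = 0
  rw [hx.2 n hn, hy.2 n hn]
  simp

theorem mul_map_mem_cofinalUltra (hk : 1 ≤ k) (hX : IsBlockSeq k X) {U V : Ultrafilter SupVec}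
    (hU : U ∈ cofinalUltra k X) (hV : V ∈ cofinalUltra k X) (a : ℕ) :
    U * V.map (supTmap a) ∈ cofinalUltra k X := by
  intro N
  refine (Ultrafilter.eventually_mul U _
    (fun z : SupVec => InSubspace k X z ∧ ∀ n < N, z n = 0)).2 ?_
  filter_upwards [hU N] with x hx
  rw [Ultrafilter.coe_map, Filter.eventually_map]
  filter_upwards [hV N] with y hy
  refine ⟨?_, fun n hn => ?_⟩
  · have := hx.1.sup_left hk hX (tmap_mem_weakSpan hX (hy.1.mem_weakSpan hk hX) a)
    rwa [show Tmap a y ⊔ (show ℕ → ℕ from x) = (show ℕ → ℕ from x) ⊔ Tmap a y from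
      sup_comm _ _] at this
  change max (x n) (y n - a) = 0
  rw [hx.2 n hn, hy.2 n hn]
  simp

/-- Ultrafilters of truncations to height `j`. -/
def levelUltra (k : ℕ) (X : ℕ → ℕ → ℕ) (j : ℕ) : Set (Ultrafilter SupVec) :=
  (fun U => U.map (supTmap (k - j))) '' cofinalUltra k X

theorem map_map_supTmap (U : Ultrafilter SupVec) (a b : ℕ) :
    (U.map (supTmap b)).map (supTmap a) = U.map (supTmap (b + a)) := by
  rw [Ultrafilter.map_map]
  congr 1
  funext x
  exact supTmap_supTmap a b x

theorem mul_mem_levelUltra (hk : 1 ≤ k) (hX : IsBlockSeq k X) {i j : ℕ} (hi : i ≤ j) (hj : j ≤ k)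
    {U V : Ultrafilter SupVec} (hU : U ∈ levelUltra k X i) (hV : V ∈ levelUltra k X j) :
    U * V ∈ levelUltra k X j := by
  obtain ⟨U, hU, rfl⟩ := hU
  obtain ⟨V, hV, rfl⟩ := hV
  refine ⟨U.map (supTmap (j - i)) * V, map_mul_mem_cofinalUltra hk hX hU hV _, ?_⟩
  simp only
  rw [ultrafilter_map_mul _ (supTmap_mul _), map_map_supTmap]
  congr 3
  omega

theorem mul_mem_levelUltra_right (hk : 1 ≤ k) (hX : IsBlockSeq k X) {i j : ℕ} (hi : i ≤ j)
    (hj : j ≤ k) {U V : Ultrafilter SupVec} (hU : U ∈ levelUltra k X j)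
    (hV : V ∈ levelUltra k X i) : U * V ∈ levelUltra k X j := by
  obtain ⟨U, hU, rfl⟩ := hU
  obtain ⟨V, hV, rfl⟩ := hV
  refine ⟨U * V.map (supTmap (j - i)), mul_map_mem_cofinalUltra hk hX hU hV _, ?_⟩
  simp only
  rw [ultrafilter_map_mul _ (supTmap_mul _), map_map_supTmap]
  congr 3
  omega

theorem exists_absorbing (hk : 1 ≤ k) (hX : IsBlockSeq k X) {j : ℕ} (hj : j ≤ k) :
    ∃ U ∈ levelUltra k X j, ∀ a, U.map (supTmap a) * U = U ∧ U * U.map (supTmap a) = U := by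
  induction j with
  | zero =>
    obtain ⟨V, hV⟩ := cofinalUltra_nonempty hk hX
    refine ⟨_, ⟨V, hV, rfl⟩, ?_⟩
    let z : SupVec := fun _ => 0
    have h0 : V.map (supTmap (k - 0)) = pure z := by
      refine Ultrafilter.eq_of_le fun s hs => ?_
      rw [Ultrafilter.coe_map, Filter.mem_map]
      filter_upwards [hV 0] with x hx
      have : supTmap (k - 0) x = z := by
        funext n
        change x n - (k - 0) = 0
        have := (hx.1.isFin hk hX).1 n
        omega
      rw [Set.mem_preimage, this]
      exact hs
    have hz : ∀ a, supTmap a z = z := fun a => funext fun n => Nat.zero_sub a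
    have hm : (pure z : Ultrafilter SupVec) * pure z = pure z := by
      refine Ultrafilter.eq_of_le fun s hs => ?_
      exact (Ultrafilter.eventually_mul _ _ (fun z => z ∈ s)).2 hs
    intro a
    simp only
    rw [h0, Ultrafilter.map_pure, hz]
    exact ⟨hm, hm⟩
  | succ j ih =>
    obtain ⟨U, hU, hab⟩ := ih (by omega)
    have hidem : U * U = U := by
      have := (hab 0).1
      have h0 : U.map (supTmap 0) = U := by
        have : supTmap 0 = id := rfl
        rw [this, Ultrafilter.map_id]
      rwa [h0] at this
    obtain ⟨V₀, hV₀, rfl⟩ := hU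
    simp only at hab hidem
    set U := V₀.map (supTmap (k - j)) with hUdef
    have hU : U ∈ levelUltra k X j := ⟨V₀, hV₀, rfl⟩
    have hstep : ∀ V : Ultrafilter SupVec, (V.map (supTmap (k - (j + 1)))).map (supTmap 1) =
        V.map (supTmap (k - j)) := fun V => by
      rw [map_map_supTmap]
      congr 2
      omega
    let S : Set (Ultrafilter SupVec) :=
      (fun V => V.map (supTmap (k - (j + 1))) * U) ''
        (cofinalUltra k X ∩ (fun V => V.map (supTmap (k - j))) ⁻¹' {U})
    have hS : ∀ W ∈ S, W ∈ levelUltra k X (j + 1) ∧ W.map (supTmap 1) = U ∧ W * U = W := by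
      rintro _ ⟨V, ⟨hV, hVU⟩, rfl⟩
      refine ⟨mul_mem_levelUltra_right hk hX (Nat.le_succ j) hj ⟨V, hV, rfl⟩ hU, ?_, ?_⟩
      · rw [ultrafilter_map_mul _ (supTmap_mul _), hstep]
        have : V.map (supTmap (k - j)) = U := hVU
        rw [this, (hab 1).2]
      · simp only
        rw [mul_assoc, hidem]
    have hcont : ∀ V : Ultrafilter SupVec, Continuous (· * V) := Ultrafilter.continuous_mul_left
    have hcomp : IsCompact S := by
      refine IsCompact.image (IsClosed.isCompact ?_)
        ((hcont U).comp (continuous_ultrafilter_map _))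
      exact isClosed_cofinalUltra.inter (isClosed_singleton.preimage (continuous_ultrafilter_map _))
    obtain ⟨W, hW, hWW⟩ := exists_idempotent_in_compact_subsemigroup hcont S
      ⟨_, V₀, ⟨hV₀, rfl⟩, rfl⟩ hcomp (by
        rintro W hW _ ⟨V, ⟨hV, hVU⟩, rfl⟩
        obtain ⟨h1, h2, h3⟩ := hS W hW
        obtain ⟨V', hV', hV'W⟩ := mul_mem_levelUltra hk hX le_rfl hj h1 ⟨V, hV, rfl⟩
        refine ⟨V', ⟨hV', ?_⟩, ?_⟩
        · change V'.map (supTmap (k - j)) = U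
          rw [← hstep]
          simp only at hV'W
          rw [hV'W, ultrafilter_map_mul _ (supTmap_mul _), h2, hstep]
          have : V.map (supTmap (k - j)) = U := hVU
          rw [this, hidem]
        · simp only at hV'W ⊢
          rw [hV'W, mul_assoc])
    obtain ⟨h1, h2, h3⟩ := hS W hW
    have hT : (U * W).map (supTmap 1) = U := by
      rw [ultrafilter_map_mul _ (supTmap_mul _), h2, (hab 1).1]
    have hr : U * W * U = U * W := by rw [mul_assoc, h3]
    have hl : U * (U * W) = U * W := by rw [← mul_assoc, hidem]
    refine ⟨U * W, mul_mem_levelUltra hk hX (Nat.le_succ j) hj hU h1, fun a => ?_⟩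
    rcases a with _ | a
    · have h0 : (U * W).map (supTmap 0) = U * W := by
        have : supTmap 0 = id := rfl
        rw [this, Ultrafilter.map_id]
      have : U * W * (U * W) = U * W := by
        rw [← mul_assoc, hr, mul_assoc, hWW]
      rw [h0]
      exact ⟨this, this⟩
    · have ha : (U * W).map (supTmap (a + 1)) = U.map (supTmap a) := by
        rw [add_comm, ← map_map_supTmap, hT]
      rw [ha]
      constructor
      · conv_lhs => rw [← hl, ← mul_assoc, (hab a).1]
        exact hl
      · conv_lhs => rw [← hr, mul_assoc, (hab a).2]
        exact hr

theorem exists_isGowers (hk : 1 ≤ k) (hX : IsBlockSeq k X) :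
    ∃ 𝒰 : Ultrafilter (ℕ → ℕ), IsGowers k X 𝒰 := by
  obtain ⟨U, ⟨V, hV, hVU⟩, hab⟩ := exists_absorbing hk hX le_rfl
  have : V = U := by
    rw [← hVU]
    simp only [Nat.sub_self]
    have : supTmap 0 = id := rfl
    rw [this, Ultrafilter.map_id]
  subst this
  refine ⟨V, hV, fun a P => ?_, fun a P => ?_⟩
  · have h := Ultrafilter.eventually_mul (V.map (supTmap a)) V P
    rw [(hab a).1] at h
    exact h
  · have h := Ultrafilter.eventually_mul V (V.map (supTmap a)) P
    rw [(hab a).2] at h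
    exact h

end Gowers

/-! ### Generic sequences -/

theorem raise_self (k : ℕ) (x : ℕ → ℕ) : raise k k x = x := by
  ext p; simp [raise, Tmap]

theorem raise_zero {k : ℕ} {x : ℕ → ℕ} (hx : ∀ p, x p ≤ k) : raise k 0 x = 0 := by
  ext p
  have := hx p
  simp only [raise, Tmap, Pi.zero_apply]
  omega

theorem tmap_sup (a : ℕ) (x y : ℕ → ℕ) : Tmap a (x ⊔ y) = Tmap a x ⊔ Tmap a y := by
  ext p
  simp only [Tmap, Pi.sup_apply]
  omega

theorem raise_tmap {k h j : ℕ} (hh : h ≤ j) (hj : j ≤ k) (x : ℕ → ℕ) :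
    raise k j (Tmap (j - h) x) = raise k h x := by
  ext p
  simp only [raise, Tmap]
  omega

theorem Ultrafilter.eventually_iff_const {α : Type*} {U : Ultrafilter α} {p : Prop} {q : α → Prop}
    (h : p ↔ ∀ᶠ x in (U : Filter α), q x) : ∀ᶠ x in (U : Filter α), (p ↔ q x) := by
  by_cases hp : p
  · filter_upwards [h.1 hp] with x hx
    exact ⟨fun _ => hx, fun _ => hp⟩
  · filter_upwards [Ultrafilter.eventually_not.2 (fun hq => hp (h.2 hq))] with x hx
    exact ⟨fun hp' => absurd hp' hp, fun hq => absurd hq hx⟩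

namespace IsGowers

variable {k : ℕ} {X : ℕ → ℕ → ℕ} {𝒰 : Ultrafilter (ℕ → ℕ)}

theorem eventually_le (hk : 1 ≤ k) (hX : IsBlockSeq k X) (hU : IsGowers k X 𝒰) :
    ∀ᶠ x in (𝒰 : Filter (ℕ → ℕ)), ∀ p, x p ≤ k := by
  filter_upwards [hU.mem 0] with x hx
  exact (hx.1.isFin hk hX).1

theorem merge (hU : IsGowers k X 𝒰) {h j : ℕ} (hh : h ≤ k) (hj : j ≤ k) (u : ℕ → ℕ)
    (P : (ℕ → ℕ) → Prop) :
    (∀ᶠ x in (𝒰 : Filter (ℕ → ℕ)), P (u ⊔ raise k (max h j) x)) ↔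
      ∀ᶠ x in (𝒰 : Filter (ℕ → ℕ)), ∀ᶠ y in (𝒰 : Filter (ℕ → ℕ)),
        P (u ⊔ raise k h x ⊔ raise k j y) := by
  rcases le_total h j with hhj | hhj
  · rw [max_eq_right hhj, hU.left (j - h) fun x => P (u ⊔ raise k j x)]
    have : ∀ x y, raise k j (Tmap (j - h) x ⊔ y) = raise k h x ⊔ raise k j y := fun x y => by
      rw [← raise_tmap hhj hj]
      exact tmap_sup _ _ _
    simp only [this, sup_assoc]
  · rw [max_eq_left hhj, hU.right (h - j) fun x => P (u ⊔ raise k h x)]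
    have : ∀ x y, raise k h (x ⊔ Tmap (h - j) y) = raise k h x ⊔ raise k j y := fun x y => by
      rw [← raise_tmap hhj hh]
      exact tmap_sup _ _ _
    simp only [this, sup_assoc]

theorem eventually_raise_zero (hk : 1 ≤ k) (hX : IsBlockSeq k X) (hU : IsGowers k X 𝒰)
    (u : ℕ → ℕ) (P : (ℕ → ℕ) → Prop) :
    (∀ᶠ x in (𝒰 : Filter (ℕ → ℕ)), P (u ⊔ raise k 0 x)) ↔ P u := by
  have : (∀ᶠ x in (𝒰 : Filter (ℕ → ℕ)), P (u ⊔ raise k 0 x)) ↔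
      ∀ᶠ _ in (𝒰 : Filter (ℕ → ℕ)), P u := by
    refine Filter.eventually_congr ?_
    filter_upwards [hU.eventually_le hk hX] with x hx
    rw [raise_zero hx, show u ⊔ (0 : ℕ → ℕ) = u from by ext p; simp]
  rw [this, Filter.eventually_const]

theorem eventually_le_encard (hk : 1 ≤ k) (hX : IsBlockSeq k X) (hU : IsGowers k X 𝒰) (M : ℕ) :
    ∀ᶠ x in (𝒰 : Filter (ℕ → ℕ)), (M : ℕ∞) ≤ {p | x p = k}.encard := by
  induction M with
  | zero => exact Filter.Eventually.of_forall fun x => by simp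
  | succ M ih =>
    rw [hU.left 0]
    filter_upwards [ih, hU.mem 0] with x hx hx0
    have hxf := hx0.1.isFin hk hX
    obtain ⟨N, hN⟩ := hxf.2.1.bddAbove
    filter_upwards [hU.mem (N + 1)] with y hy
    have hyf := hy.1.isFin hk hX
    obtain ⟨p, hp⟩ := hyf.2.2
    have hpx : x p ≠ k := fun h => by
      have h1 : p ≤ N := hN (show x p ≠ 0 by omega)
      have := hy.2 p (by omega)
      omega
    have hsub : insert p {p | x p = k} ⊆ {p | (Tmap 0 x ⊔ y) p = k} := by
      rintro r (rfl | hr)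
      · have := hxf.1 r
        simp only [Set.mem_ofPred_eq, Pi.sup_apply, Tmap]
        omega
      · have := hyf.1 r
        simp only [Set.mem_ofPred_eq] at hr
        simp only [Set.mem_ofPred_eq, Pi.sup_apply, Tmap]
        omega
    refine le_trans ?_ (Set.encard_le_encard hsub)
    rw [Set.encard_insert_of_notMem (s := {p | x p = k}) hpx]
    push_cast
    gcongr

/-- A sequence each of whose terms is taken from a prescribed large set depending on the
previous terms. -/
theorem exists_blockLE (hk : 1 ≤ k) (hX : IsBlockSeq k X) (hU : IsGowers k X 𝒰)
    (A : (ℕ → ℕ → ℕ) → ℕ → Set (ℕ → ℕ)) (hA : ∀ Y n, A Y n ∈ 𝒰)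
    (hcongr : ∀ Y Y' n, (∀ i < n, Y i = Y' i) → A Y n = A Y' n) :
    ∃ Y, BlockLE k Y X ∧ ∀ n, Y n ∈ A Y n := by
  have hex : ∀ l : List (ℕ → ℕ), ∃ x, x ∈ A (fun i => l.getD i 0) l.length ∧
      InSubspace k X x ∧ ((∃ N, ∀ v ∈ l, ∀ p, v p ≠ 0 → p < N) → ∀ v ∈ l, VecLt v x) := by
    intro l
    by_cases hN : ∃ N, ∀ v ∈ l, ∀ p, v p ≠ 0 → p < N
    · obtain ⟨N, hN⟩ := hN
      obtain ⟨x, hx1, hx2⟩ := 𝒰.nonempty_of_mem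
        (Filter.inter_mem (hA (fun i => l.getD i 0) l.length) (hU.mem N))
      refine ⟨x, hx1, hx2.1, fun _ v hv m n hm hn => ?_⟩
      by_contra hmn
      exact hn (hx2.2 n (by have := hN v hv m hm; omega))
    · obtain ⟨x, hx1, hx2⟩ := 𝒰.nonempty_of_mem
        (Filter.inter_mem (hA (fun i => l.getD i 0) l.length) (hU.mem 0))
      exact ⟨x, hx1, hx2.1, fun h => absurd h hN⟩
  choose g hg1 hg2 hg3 using hex
  let L : ℕ → List (ℕ → ℕ) := fun n => Nat.rec [] (fun _ l => l ++ [g l]) n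
  have hL : ∀ n, L (n + 1) = L n ++ [g (L n)] := fun n => rfl
  have hlen : ∀ n, (L n).length = n := fun n => by
    induction n with
    | zero => rfl
    | succ n ih => rw [hL]; simp [ih]
  have hget : ∀ n, ∀ i < n, (L n).getD i 0 = g (L i) := fun n => by
    induction n with
    | zero => intro i hi; omega
    | succ n ih =>
      intro i hi
      rw [hL]
      rcases Nat.lt_succ_iff_lt_or_eq.1 hi with h | rfl
      · rw [List.getD_append _ _ _ _ (by rw [hlen]; exact h), ih i h]
      · rw [List.getD_append_right _ _ _ _ (by rw [hlen]), hlen]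
        simp
  have hfin : ∀ n, ∃ N, ∀ v ∈ L n, ∀ p, v p ≠ 0 → p < N := fun n => by
    induction n with
    | zero => exact ⟨0, fun v hv => by simp [L] at hv⟩
    | succ n ih =>
      obtain ⟨N, hN⟩ := ih
      obtain ⟨M, hM⟩ := ((hg2 (L n)).isFin hk hX).2.1.bddAbove
      refine ⟨max N (M + 1), fun v hv p hp => ?_⟩
      rw [hL, List.mem_append, List.mem_singleton] at hv
      rcases hv with hv | rfl
      · exact lt_of_lt_of_le (hN v hv p hp) (le_max_left _ _)
      · have : p ≤ M := hM hp
        omega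
  refine ⟨fun n => g (L n), ⟨⟨fun n => (hg2 _).isFin hk hX, fun n => ?_⟩, fun n => hg2 _⟩,
    fun n => ?_⟩
  · exact hg3 (L (n + 1)) (hfin (n + 1)) _ (by rw [hL]; simp)
  · have := hg1 (L n)
    rwa [hlen, hcongr _ (fun n => g (L n)) n (hget n)] at this

end IsGowers

/-! ### Partial constructions of members of a family -/

/-- A partially built block sequence: the completed terms, the part of the current term built
so far, and the height to which a generic vector is still to be added to the current term. -/
structure PState where
  /-- the completed terms -/
  done : List (ℕ → ℕ)
  /-- the initial part of the current term -/
  cur : ℕ → ℕ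
  /-- the promised height of the rest of the current term -/
  prom : ℕ

/-- Extension of a partially built sequence by one vector `y`, used at height `h`. -/
inductive PStep (k : ℕ) (F : Set (List (ℕ → ℕ))) (y : ℕ → ℕ) : ℕ → PState → PState → Prop
  | grow (s : List (ℕ → ℕ)) (u : ℕ → ℕ) (h j : ℕ) (hh : h ≤ k) (hj : j ≤ k) :
      PStep k F y h ⟨s, u, max h j⟩ ⟨s, u ⊔ raise k h y, j⟩
  | fresh (s : List (ℕ → ℕ)) (u : ℕ → ℕ) (h j : ℕ) (hh : h ≤ k) (hj : j ≤ k)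
      (hm : max h j = k) (hs : s ++ [u] ∉ F) :
      PStep k F y h ⟨s, u, 0⟩ ⟨s ++ [u], raise k h y, j⟩

/-- Extension of a partially built sequence by the vectors `Y i, …, Y (n - 1)`. -/
inductive PRun (k : ℕ) (F : Set (List (ℕ → ℕ))) (Y : ℕ → ℕ → ℕ) (i : ℕ) (q : PState) :
    ℕ → PState → Prop
  | refl : PRun k F Y i q i q
  | step {n h : ℕ} {q' q'' : PState} (hr : PRun k F Y i q n q') (hs : PStep k F (Y n) h q' q'') :
      PRun k F Y i q (n + 1) q''

/-- The value forced on a property by a partially built sequence. -/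
def Forces (k : ℕ) (𝒰 : Ultrafilter (ℕ → ℕ)) (P : List (ℕ → ℕ) → Prop) (q : PState) : Prop :=
  ∀ᶠ x in (𝒰 : Filter (ℕ → ℕ)), P (q.done ++ [q.cur ⊔ raise k q.prom x])

/-- A property of sequences outside `F` that is decided by generic one-term extensions. -/
def Coherent (𝒰 : Ultrafilter (ℕ → ℕ)) (F : Set (List (ℕ → ℕ))) (P : List (ℕ → ℕ) → Prop) :
    Prop :=
  ∀ s, s ≠ [] → s ∉ F → (P s ↔ ∀ᶠ x in (𝒰 : Filter (ℕ → ℕ)), P (s ++ [x]))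

/-- Generic extensions of the sequence to a member of `F` have colour `c`. -/
inductive ForcesColor (𝒰 : Ultrafilter (ℕ → ℕ)) (F : Set (List (ℕ → ℕ))) (f : List (ℕ → ℕ) → ℕ)
    (c : ℕ) : List (ℕ → ℕ) → Prop
  | base (s : List (ℕ → ℕ)) (hs : s ∈ F) (hf : f s = c) : ForcesColor 𝒰 F f c s
  | step (s : List (ℕ → ℕ)) (hs : s ∉ F) (A : Set (ℕ → ℕ)) (hA : A ∈ 𝒰)
      (h : ∀ x ∈ A, ForcesColor 𝒰 F f c (s ++ [x])) : ForcesColor 𝒰 F f c s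

theorem ForcesColor.unique {𝒰 : Ultrafilter (ℕ → ℕ)} {F : Set (List (ℕ → ℕ))}
    {f : List (ℕ → ℕ) → ℕ} {c c' : ℕ} {s : List (ℕ → ℕ)} (h : ForcesColor 𝒰 F f c s)
    (h' : ForcesColor 𝒰 F f c' s) : c = c' := by
  induction h with
  | base s hs hf =>
    cases h' with
    | base _ _ hf' => exact hf.symm.trans hf'
    | step _ hs' => exact absurd hs hs'
  | step s hs A hA h ih =>
    cases h' with
    | base _ hs' => exact absurd hs' hs
    | step _ _ B hB h'' =>
      obtain ⟨x, hx, hx'⟩ := 𝒰.nonempty_of_mem (Filter.inter_mem hA hB)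
      exact ih x hx (h'' x hx')

theorem forcesColor_iff {𝒰 : Ultrafilter (ℕ → ℕ)} {F : Set (List (ℕ → ℕ))}
    {f : List (ℕ → ℕ) → ℕ} {c : ℕ} {s : List (ℕ → ℕ)} (hs : s ∈ F) :
    ForcesColor 𝒰 F f c s ↔ f s = c := by
  refine ⟨fun h => ?_, ForcesColor.base s hs⟩
  cases h with
  | base _ _ hf => exact hf
  | step _ hs' => exact absurd hs hs'

theorem coherent_forcesColor (𝒰 : Ultrafilter (ℕ → ℕ)) (F : Set (List (ℕ → ℕ)))
    (f : List (ℕ → ℕ) → ℕ) (c : ℕ) : Coherent 𝒰 F (ForcesColor 𝒰 F f c) := by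
  intro s _ hs
  constructor
  · intro h
    cases h with
    | base _ hs' => exact absurd hs' hs
    | step _ _ A hA h => exact Filter.mem_of_superset hA h
  · intro h
    exact ForcesColor.step s hs _ h fun x hx => hx

/-- The states reachable from `I` in `n` steps. -/
def preach (k : ℕ) (F : Set (List (ℕ → ℕ))) (Y : ℕ → ℕ → ℕ) (I : Set PState) (n : ℕ) :
    Set PState :=
  {q | ∃ q₀ ∈ I, PRun k F Y 0 q₀ n q}

/-- The states with nothing built. -/
def initStates (k : ℕ) : Set PState := (fun j => ⟨[], 0, j⟩) '' Set.Iic k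

/-- The colours forced by some valid state at level `n`. -/
def forcedColors (k : ℕ) (𝒰 : Ultrafilter (ℕ → ℕ)) (F : Set (List (ℕ → ℕ)))
    (f : List (ℕ → ℕ) → ℕ) (Y : ℕ → ℕ → ℕ) (n : ℕ) : Set ℕ :=
  {c | ∃ q ∈ preach k F Y {⟨[], 0, k⟩} n, Forces k 𝒰 (ForcesColor 𝒰 F f c) q}

section Reach

variable {k : ℕ} {F : Set (List (ℕ → ℕ))} {Y Y' : ℕ → ℕ → ℕ}

theorem PRun.congr {i n : ℕ} {q q' : PState} (h : ∀ m < n, Y m = Y' m)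
    (hr : PRun k F Y i q n q') : PRun k F Y' i q n q' := by
  induction hr with
  | refl => exact .refl
  | @step n g a b hr hs ih =>
    refine .step (ih fun m hm => h m (by omega)) (h n (by omega) ▸ hs)

theorem preach_congr {I : Set PState} {n : ℕ} (h : ∀ m < n, Y m = Y' m) :
    preach k F Y I n = preach k F Y' I n := by
  ext q
  constructor
  · rintro ⟨q₀, hq, hr⟩
    exact ⟨q₀, hq, hr.congr h⟩
  · rintro ⟨q₀, hq, hr⟩
    exact ⟨q₀, hq, hr.congr fun m hm => (h m hm).symm⟩

theorem PRun.trans {i m n : ℕ} {q q' q'' : PState} (h : PRun k F Y i q m q')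
    (h' : PRun k F Y m q' n q'') : PRun k F Y i q n q'' := by
  induction h' with
  | refl => exact h
  | step _ hs ih => exact .step ih hs

theorem PRun.le {i n : ℕ} {q q' : PState} (h : PRun k F Y i q n q') : i ≤ n := by
  induction h with
  | refl => exact le_rfl
  | step _ _ ih => omega

theorem preach_zero (I : Set PState) : preach k F Y I 0 = I := by
  ext q
  constructor
  · rintro ⟨q₀, hq, hr⟩
    cases hr
    exact hq
  · exact fun h => ⟨q, h, .refl⟩

theorem preach_succ_subset (I : Set PState) (n : ℕ) :
    preach k F Y I (n + 1) ⊆ (fun z : PState × Bool × ℕ × ℕ =>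
      if z.2.1 then (⟨z.1.done, z.1.cur ⊔ raise k z.2.2.1 (Y n), z.2.2.2⟩ : PState) else
        ⟨z.1.done ++ [z.1.cur], raise k z.2.2.1 (Y n), z.2.2.2⟩) ''
          (preach k F Y I n ×ˢ Set.univ ×ˢ Set.Iic k ×ˢ Set.Iic k) := by
  rintro q ⟨q₀, hq, hr⟩
  cases hr with
  | @step _ h _ _ hr hs =>
    cases hs with
    | grow s u _ j hh hj =>
      exact ⟨(⟨s, u, max h j⟩, true, h, j), ⟨⟨q₀, hq, hr⟩, trivial, hh, hj⟩, by simp⟩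
    | fresh s u _ j hh hj hm hs =>
      exact ⟨(⟨s, u, 0⟩, false, h, j), ⟨⟨q₀, hq, hr⟩, trivial, hh, hj⟩, by simp⟩

theorem finite_preach {I : Set PState} (hI : I.Finite) (n : ℕ) : (preach k F Y I n).Finite := by
  induction n with
  | zero => rwa [preach_zero]
  | succ n ih =>
    refine Set.Finite.subset (Set.Finite.image _ (ih.prod (Set.finite_univ.prod
      ((Set.finite_Iic k).prod (Set.finite_Iic k))))) (preach_succ_subset I n)

theorem encard_preach_le (q₀ : PState) (n : ℕ) :
    (preach k F Y {q₀} n).encard ≤ (((2 * ((k + 1) * (k + 1))) ^ n : ℕ) : ℕ∞) := by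
  induction n with
  | zero => simp [preach_zero]
  | succ n ih =>
    refine (Set.encard_le_encard (preach_succ_subset _ n)).trans ((Set.encard_image_le _ _).trans ?_)
    have h2 : (Set.univ : Set Bool).encard = 2 := by
      rw [Set.encard_univ]; simp
    have hk : (Set.Iic k).encard = (k + 1 : ℕ) := by
      rw [Set.encard_eq_coe_toFinset_card]; simp
    rw [Set.encard_prod, Set.encard_prod, Set.encard_prod, h2, hk, pow_succ]
    push_cast
    push_cast at ih
    gcongr

theorem forcedColors_congr {𝒰 : Ultrafilter (ℕ → ℕ)} {f : List (ℕ → ℕ) → ℕ} {n : ℕ}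
    (h : ∀ m < n, Y m = Y' m) : forcedColors k 𝒰 F f Y n = forcedColors k 𝒰 F f Y' n := by
  simp only [forcedColors, preach_congr h]

theorem Forces.unique {𝒰 : Ultrafilter (ℕ → ℕ)} {f : List (ℕ → ℕ) → ℕ} {c c' : ℕ} {q : PState}
    (h : Forces k 𝒰 (ForcesColor 𝒰 F f c) q) (h' : Forces k 𝒰 (ForcesColor 𝒰 F f c') q) :
    c = c' := by
  obtain ⟨x, hx, hx'⟩ := (h.and h').exists
  exact hx.unique hx'

theorem encard_forcedColors_le (𝒰 : Ultrafilter (ℕ → ℕ)) (f : List (ℕ → ℕ) → ℕ) (n : ℕ) :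
    (forcedColors k 𝒰 F f Y n).encard ≤ (((2 * ((k + 1) * (k + 1))) ^ n : ℕ) : ℕ∞) := by
  refine le_trans ?_ (encard_preach_le (F := F) (Y := Y) ⟨[], 0, k⟩ n)
  have : ∀ c, ∃ q, c ∈ forcedColors k 𝒰 F f Y n → q ∈ preach k F Y {⟨[], 0, k⟩} n ∧
      Forces k 𝒰 (ForcesColor 𝒰 F f c) q := fun c => by
    by_cases h : c ∈ forcedColors k 𝒰 F f Y n
    · obtain ⟨q, hq⟩ := h
      exact ⟨q, fun _ => hq⟩
    · exact ⟨⟨[], 0, 0⟩, fun h' => absurd h' h⟩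
  choose g hg using this
  refine Set.encard_le_encard_of_injOn (f := g) (fun c hc => (hg c hc).1) ?_
  intro c hc c' hc' h
  exact (hg c hc).2.unique (h ▸ (hg c' hc').2)

theorem forcedColors_finite (𝒰 : Ultrafilter (ℕ → ℕ)) (f : List (ℕ → ℕ) → ℕ) (n : ℕ) :
    (forcedColors k 𝒰 F f Y n).Finite :=
  Set.finite_of_encard_le_coe (encard_forcedColors_le 𝒰 f n)

theorem forcedColors_zero_subsingleton (𝒰 : Ultrafilter (ℕ → ℕ)) (f : List (ℕ → ℕ) → ℕ) :
    (forcedColors k 𝒰 F f Y 0).Subsingleton := by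
  rintro c ⟨q, hq, h⟩ c' ⟨q', hq', h'⟩
  rw [preach_zero, Set.mem_singleton_iff] at hq hq'
  subst hq hq'
  exact h.unique h'

end Reach

section Generic

variable {k : ℕ} {X : ℕ → ℕ → ℕ} {𝒰 : Ultrafilter (ℕ → ℕ)} {F : Set (List (ℕ → ℕ))}

theorem forces_grow (hU : IsGowers k X 𝒰) (P : List (ℕ → ℕ) → Prop) (s : List (ℕ → ℕ))
    (u : ℕ → ℕ) {h j : ℕ} (hh : h ≤ k) (hj : j ≤ k) :
    Forces k 𝒰 P ⟨s, u, max h j⟩ ↔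
      ∀ᶠ y in (𝒰 : Filter (ℕ → ℕ)), Forces k 𝒰 P ⟨s, u ⊔ raise k h y, j⟩ :=
  hU.merge hh hj u fun v => P (s ++ [v])

theorem forces_zero (hk : 1 ≤ k) (hX : IsBlockSeq k X) (hU : IsGowers k X 𝒰)
    (P : List (ℕ → ℕ) → Prop) (s : List (ℕ → ℕ)) (u : ℕ → ℕ) :
    Forces k 𝒰 P ⟨s, u, 0⟩ ↔ P (s ++ [u]) :=
  hU.eventually_raise_zero hk hX u fun v => P (s ++ [v])

theorem forces_fresh (hk : 1 ≤ k) (hX : IsBlockSeq k X) (hU : IsGowers k X 𝒰)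
    {P : List (ℕ → ℕ) → Prop} (hP : Coherent 𝒰 F P) {s : List (ℕ → ℕ)} {u : ℕ → ℕ} {h j : ℕ}
    (hh : h ≤ k) (hj : j ≤ k) (hm : max h j = k) (hs : s ++ [u] ∉ F) :
    Forces k 𝒰 P ⟨s, u, 0⟩ ↔
      ∀ᶠ y in (𝒰 : Filter (ℕ → ℕ)), Forces k 𝒰 P ⟨s ++ [u], raise k h y, j⟩ := by
  have h1 := hU.merge hh hj 0 fun v => P (s ++ [u] ++ [v])
  have h0 : ∀ v : ℕ → ℕ, 0 ⊔ v = v := fun v => by ext p; simp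
  simp only [hm, raise_self, h0] at h1
  rw [forces_zero hk hX hU, hP _ (by simp) hs, h1]
  rfl

theorem eventually_forces_iff (hk : 1 ≤ k) (hX : IsBlockSeq k X) (hU : IsGowers k X 𝒰)
    {P : List (ℕ → ℕ) → Prop} (hP : Coherent 𝒰 F P) (q : PState) :
    ∀ᶠ y in (𝒰 : Filter (ℕ → ℕ)), ∀ h q', PStep k F y h q q' →
      (Forces k 𝒰 P q ↔ Forces k 𝒰 P q') := by
  have key : ∀ h ∈ Set.Iic k, ∀ j ∈ Set.Iic k, ∀ᶠ y in (𝒰 : Filter (ℕ → ℕ)),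
      (q.prom = max h j → (Forces k 𝒰 P q ↔ Forces k 𝒰 P ⟨q.done, q.cur ⊔ raise k h y, j⟩)) ∧
      (q.prom = 0 → max h j = k → q.done ++ [q.cur] ∉ F →
        (Forces k 𝒰 P q ↔ Forces k 𝒰 P ⟨q.done ++ [q.cur], raise k h y, j⟩)) := by
    intro h hh j hj
    obtain ⟨s, u, r⟩ := q
    refine Filter.Eventually.and ?_ ?_
    · by_cases hr : r = max h j
      · subst hr
        filter_upwards [Ultrafilter.eventually_iff_const (forces_grow hU P s u hh hj)] with y hy _
        exact hy
      · exact Filter.Eventually.of_forall fun y h => absurd h hr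
    · by_cases hr : r = 0 ∧ max h j = k ∧ s ++ [u] ∉ F
      · obtain ⟨rfl, hm, hs⟩ := hr
        filter_upwards [Ultrafilter.eventually_iff_const
          (forces_fresh hk hX hU hP hh hj hm hs)] with y hy _ _ _
        exact hy
      · exact Filter.Eventually.of_forall fun y h1 h2 h3 => absurd ⟨h1, h2, h3⟩ hr
  have key2 : ∀ᶠ y in (𝒰 : Filter (ℕ → ℕ)), ∀ h ∈ Set.Iic k, ∀ j ∈ Set.Iic k,
      (q.prom = max h j → (Forces k 𝒰 P q ↔ Forces k 𝒰 P ⟨q.done, q.cur ⊔ raise k h y, j⟩)) ∧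
      (q.prom = 0 → max h j = k → q.done ++ [q.cur] ∉ F →
        (Forces k 𝒰 P q ↔ Forces k 𝒰 P ⟨q.done ++ [q.cur], raise k h y, j⟩)) :=
    (Filter.eventually_all_finite (Set.finite_Iic k)).2 fun h hh =>
      (Filter.eventually_all_finite (Set.finite_Iic k)).2 fun j hj => key h hh j hj
  filter_upwards [key2] with y hy h q' hs
  cases hs with
  | grow s u h j hh hj => exact (hy h hh j hj).1 rfl
  | fresh s u h j hh hj hm hs => exact (hy h hh j hj).2 rfl hm hs

/-- A sequence that is generic for the partial constructions of members of `F`, as far as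
the colours and the properties from `E` are concerned. -/
structure IsGenericSeq (k : ℕ) (X : ℕ → ℕ → ℕ) (𝒰 : Ultrafilter (ℕ → ℕ))
    (F : Set (List (ℕ → ℕ))) (f : List (ℕ → ℕ) → ℕ) (E : Set PState → Set (List (ℕ → ℕ) → Prop))
    (B : Set PState → Set (ℕ → ℕ)) (Y : ℕ → ℕ → ℕ) : Prop where
  blockLE : BlockLE k Y X
  mem : ∀ n, Y n ∈ B (preach k F Y (initStates k) n)
  encard_le : ∀ n, (forcedColors k 𝒰 F f Y (n + 1)).encard ≤ {p | Y n p = k}.encard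
  color_iff : ∀ {i n q q' c}, c ∈ forcedColors k 𝒰 F f Y i → q ∈ preach k F Y (initStates k) i →
    PRun k F Y i q n q' →
      (Forces k 𝒰 (ForcesColor 𝒰 F f c) q ↔ Forces k 𝒰 (ForcesColor 𝒰 F f c) q')
  prop_iff : ∀ {i n q q' P}, P ∈ E (preach k F Y (initStates k) i) →
    q ∈ preach k F Y (initStates k) i → PRun k F Y i q n q' →
      (Forces k 𝒰 P q ↔ Forces k 𝒰 P q')

theorem finite_initStates (k : ℕ) : (initStates k).Finite := (Set.finite_Iic k).image _

theorem mem_preach_of_run {Y : ℕ → ℕ → ℕ} {I : Set PState} {i n : ℕ} {q q' : PState}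
    (hq : q ∈ preach k F Y I i) (h : PRun k F Y i q n q') : q' ∈ preach k F Y I n := by
  obtain ⟨q₀, hq₀, hr⟩ := hq
  exact ⟨q₀, hq₀, hr.trans h⟩

theorem exists_isGenericSeq (hk : 1 ≤ k) (hX : IsBlockSeq k X) (hU : IsGowers k X 𝒰)
    (f : List (ℕ → ℕ) → ℕ) (E : Set PState → Set (List (ℕ → ℕ) → Prop))
    (hE : ∀ Q, Q.Finite → (E Q).Finite) (hEF : ∀ Q, ∀ P ∈ E Q, Coherent 𝒰 F P)
    (B : Set PState → Set (ℕ → ℕ)) (hB : ∀ Q, Q.Finite → B Q ∈ 𝒰) :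
    ∃ Y, IsGenericSeq k X 𝒰 F f E B Y := by
  let Pr : (ℕ → ℕ → ℕ) → ℕ → Set (List (ℕ → ℕ) → Prop) := fun Y i =>
    (fun c => ForcesColor 𝒰 F f c) '' forcedColors k 𝒰 F f Y i ∪
      E (preach k F Y (initStates k) i)
  have hPrfin : ∀ Y i, (Pr Y i).Finite := fun Y i =>
    ((forcedColors_finite 𝒰 f i).image _).union
      (hE _ (finite_preach (finite_initStates k) i))
  have hPr : ∀ Y i, ∀ P ∈ Pr Y i, Coherent 𝒰 F P := by
    rintro Y i P (⟨c, _, rfl⟩ | hP)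
    · exact coherent_forcesColor 𝒰 F f c
    · exact hEF _ P hP
  have hPrc : ∀ {Y Y' : ℕ → ℕ → ℕ} {n : ℕ}, (∀ i < n, Y i = Y' i) → Pr Y n = Pr Y' n := by
    intro Y Y' n h
    simp only [Pr, preach_congr h, forcedColors_congr h]
  let A : (ℕ → ℕ → ℕ) → ℕ → Set (ℕ → ℕ) := fun Y n =>
    {y | y ∈ B (preach k F Y (initStates k) n) ∧
      (((2 * ((k + 1) * (k + 1))) ^ (n + 1) : ℕ) : ℕ∞) ≤ {p | y p = k}.encard ∧
      ∀ i ∈ Set.Iic n, ∀ P ∈ Pr Y i, ∀ q ∈ preach k F Y (initStates k) n,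
        ∀ h q', PStep k F y h q q' → (Forces k 𝒰 P q ↔ Forces k 𝒰 P q')}
  obtain ⟨Y, hYX, hY⟩ := hU.exists_blockLE hk hX A (fun Y n => by
    refine Filter.Eventually.and (hB _ (finite_preach (finite_initStates k) n)) <|
      (hU.eventually_le_encard hk hX _).and ?_
    refine (Filter.eventually_all_finite (Set.finite_Iic n)).2 fun i _ => ?_
    refine (Filter.eventually_all_finite (hPrfin Y i)).2 fun P hP => ?_
    refine (Filter.eventually_all_finite (finite_preach (finite_initStates k) n)).2 fun q _ => ?_
    exact eventually_forces_iff hk hX hU (hPr Y i P hP) q) (fun Y Y' n h => by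
      have : ∀ i ∈ Set.Iic n, Pr Y i = Pr Y' i := fun i hi =>
        hPrc fun m hm => h m (lt_of_lt_of_le hm hi)
      ext y
      simp only [A, preach_congr h, Set.mem_ofPred_eq]
      refine and_congr_right fun _ => and_congr_right fun _ => ?_
      refine forall_congr' fun i => forall_congr' fun hi => ?_
      rw [this i hi])
  have main : ∀ {i n q q' P}, P ∈ Pr Y i → q ∈ preach k F Y (initStates k) i →
      PRun k F Y i q n q' → (Forces k 𝒰 P q ↔ Forces k 𝒰 P q') := by
    intro i n q q' P hP hq hr
    induction hr with
    | refl => exact Iff.rfl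
    | @step n h a b hr hs ih =>
      exact ih.trans ((hY n).2.2 i hr.le P hP a (mem_preach_of_run hq hr) h b hs)
  exact ⟨Y, hYX, fun n => (hY n).1, fun n => (encard_forcedColors_le 𝒰 f _).trans (hY n).2.1,
    fun hc => main (Or.inl ⟨_, hc, rfl⟩), fun hP => main (Or.inr hP)⟩

end Generic

/-! ### Labels for colours -/

section Label

variable {k : ℕ} {X : ℕ → ℕ → ℕ} {𝒰 : Ultrafilter (ℕ → ℕ)} {F : Set (List (ℕ → ℕ))}

theorem forces_iff_of_pstep_zero (hk : 1 ≤ k) (hX : IsBlockSeq k X) (hU : IsGowers k X 𝒰)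
    {P : List (ℕ → ℕ) → Prop} (hP : Coherent 𝒰 F P) {y : ℕ → ℕ} (hy : ∀ p, y p ≤ k)
    {q q' : PState} (h : PStep k F y 0 q q') : Forces k 𝒰 P q ↔ Forces k 𝒰 P q' := by
  cases h with
  | grow s u _ j hh hj =>
    rw [raise_zero hy, show u ⊔ (0 : ℕ → ℕ) = u by ext p; simp, Nat.zero_max]
  | fresh s u _ j hh hj hm hs =>
    rw [forces_fresh hk hX hU hP hh hj hm hs]
    have : ∀ᶠ y' in (𝒰 : Filter (ℕ → ℕ)), (Forces k 𝒰 P ⟨s ++ [u], raise k 0 y', j⟩ ↔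
        Forces k 𝒰 P ⟨s ++ [u], raise k 0 y, j⟩) := by
      filter_upwards [hU.eventually_le hk hX] with y' hy'
      rw [raise_zero hy', raise_zero hy]
    rw [Filter.eventually_congr this, Filter.eventually_const]

/-- The vector with value `h` at `p` and `0` elsewhere. -/
def pointVec (p h : ℕ) : ℕ → ℕ := fun n => if n = p then h else 0

theorem exists_canonical_of_labels (hk : 1 ≤ k) (f : List (ℕ → ℕ) → ℕ) {Y : ℕ → ℕ → ℕ}
    (hY : BlockLE k Y X) (D : ℕ → Set ℕ) (hD0 : (D 0).Subsingleton) (hDfin : ∀ n, (D n).Finite)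
    (hDc : ∀ n, (D (n + 1)).encard ≤ {p | Y n p = k}.encard)
    (hmem : ∀ t ∈ F ∩ Approx k Y, ∃ n, f t ∈ D n)
    (hlab : ∀ c m, c ∈ D (m + 1) → c ∉ D m → ∃ h, 1 ≤ h ∧ ∀ t ∈ F ∩ Approx k Y, f t = c →
      ∃ v, IsComb k X t [v] ∧ ∀ p, Y m p = k → v p = h) :
    ∃ φ : List (ℕ → ℕ) → List (ℕ → ℕ),
      (∀ t ∈ F ∩ Approx k Y, ∃ c : List (ℕ → ℕ), IsComb k X t c ∧ ListInner (φ t) c) ∧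
      ∀ s ∈ F ∩ Approx k Y, ∀ t ∈ F ∩ Approx k Y, (f s = f t ↔ φ s = φ t) := by
  have hg : ∀ n, ∃ g : ℕ → ℕ, D (n + 1) ⊆ g ⁻¹' {p | Y n p = k} ∧ Set.InjOn g (D (n + 1)) :=
    fun n => (hDfin _).exists_injOn_of_encard_le (hDc n)
  choose g hg1 hg2 using hg
  have hL : ∀ c, ∃ L : List (ℕ → ℕ), (∃ n, c ∈ D n) → (c ∈ D 0 ∧ L = []) ∨
      ∃ m h, c ∈ D (m + 1) ∧ 1 ≤ h ∧ L = [pointVec (g m c) h] ∧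
        ∀ t ∈ F ∩ Approx k Y, f t = c → ∃ v, IsComb k X t [v] ∧ ∀ p, Y m p = k → v p = h := by
    intro c
    by_cases hc : ∃ n, c ∈ D n
    · have h1 := Nat.find_spec hc
      have h2 := fun m (hm : m < Nat.find hc) => Nat.find_min hc hm
      rcases hn : Nat.find hc with _ | m
      · rw [hn] at h1
        exact ⟨[], fun _ => Or.inl ⟨h1, rfl⟩⟩
      · rw [hn] at h1
        obtain ⟨h, hh, ht⟩ := hlab c m h1 (h2 m (by omega))
        exact ⟨_, fun _ => Or.inr ⟨m, h, h1, hh, rfl, ht⟩⟩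
    · exact ⟨[], fun h => absurd h hc⟩
  choose L hL using hL
  refine ⟨fun t => L (f t), fun t ht => ?_, fun s hs t ht => ⟨fun h => congrArg L h, fun h => ?_⟩⟩
  · rcases hL _ (hmem t ht) with ⟨_, h⟩ | ⟨m, h, hm, hh, hLc, hv⟩
    · refine ⟨[], ⟨fun _ => ∅, fun _ _ => 0, by simp, by simp⟩, [], by simp, by simp [h], ?_⟩
      simp [h]
    · obtain ⟨v, hv1, hv2⟩ := hv t ht rfl
      refine ⟨[v], hv1, [v], List.Sublist.refl _, by simp [hLc], ?_⟩
      intro i hi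
      simp only [hLc, List.length_singleton] at hi
      obtain rfl : i = 0 := by omega
      simp only [hLc, List.getD_cons_zero]
      intro n hn
      simp only [pointVec] at hn ⊢
      split_ifs at hn ⊢ with hnp
      · rw [hnp]
        exact (hv2 _ (hg1 m hm)).symm
      · exact absurd rfl hn
  · simp only at h
    rcases hL _ (hmem s hs) with ⟨h1, h2⟩ | ⟨m, a, hm, ha, hLc, -⟩
    · rcases hL _ (hmem t ht) with ⟨h1', h2'⟩ | ⟨m', a', hm', ha', hLc', -⟩
      · exact hD0 h1 h1'
      · rw [h2, hLc'] at h
        simp at h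
    · rcases hL _ (hmem t ht) with ⟨h1', h2'⟩ | ⟨m', a', hm', ha', hLc', -⟩
      · rw [h2', hLc] at h
        simp at h
      · rw [hLc, hLc'] at h
        have h3 := congrFun (List.cons_eq_cons.1 h).1 (g m (f s))
        simp only [pointVec, if_true] at h3
        have hp : g m (f s) = g m' (f t) := by
          by_contra hne
          rw [if_neg hne] at h3
          omega
        have e1 : Y m (g m (f s)) = k := hg1 m hm
        have e2 : Y m' (g m (f s)) = k := by
          rw [hp]
          exact hg1 m' hm'
        have : m = m' := by
          by_contra hne
          have := hY.1.eq_zero hk hne (p := g m (f s)) (by omega)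
          omega
        subst this
        exact hg2 m hm hm' hp

end Label

/-! ### Runs coming from words of heights -/

section Words

variable {k : ℕ} {F : Set (List (ℕ → ℕ))} {Y : ℕ → ℕ → ℕ}

/-- The maximum of `b` and of the heights `w i` for `i ∈ [m, n)`. -/
def topMax (w : ℕ → ℕ) (m n b : ℕ) : ℕ := max ((Finset.Ico m n).sup w) b

theorem topMax_self (w : ℕ → ℕ) (m b : ℕ) : topMax w m m b = b := by simp [topMax]

theorem topMax_succ (w : ℕ → ℕ) {m n : ℕ} (h : m ≤ n) (b : ℕ) :
    topMax w m (n + 1) b = topMax w m n (max (w n) b) := by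
  have : Finset.Ico m (n + 1) = insert n (Finset.Ico m n) := by
    ext x
    simp only [Finset.mem_Ico, Finset.mem_insert]
    omega
  simp only [topMax, this, Finset.sup_insert]
  omega

theorem topMax_succ_left (w : ℕ → ℕ) {m n : ℕ} (h : m < n) (b : ℕ) :
    topMax w m n b = max (w m) (topMax w (m + 1) n b) := by
  have : Finset.Ico m n = insert m (Finset.Ico (m + 1) n) := by
    ext x
    simp only [Finset.mem_Ico, Finset.mem_insert]
    omega
  simp only [topMax, this, Finset.sup_insert]
  omega

theorem topMax_le {w : ℕ → ℕ} (hw : ∀ i, w i ≤ k) (m n : ℕ) {b : ℕ} (hb : b ≤ k) :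
    topMax w m n b ≤ k :=
  max_le (Finset.sup_le fun i _ => hw i) hb

theorem topMax_eq {w : ℕ → ℕ} (hw : ∀ i, w i ≤ k) {m n i b : ℕ} (hb : b ≤ k) (hm : m ≤ i)
    (hn : i < n) (hi : w i = k) : topMax w m n b = k := by
  refine le_antisymm (topMax_le hw m n hb) ?_
  rw [← hi]
  exact (Finset.le_sup (f := w) (Finset.mem_Ico.2 ⟨hm, hn⟩)).trans (le_max_left _ _)

theorem prun_of_word {w : ℕ → ℕ} (hw : ∀ i, w i ≤ k) (s : List (ℕ → ℕ)) {m n : ℕ} (h : m ≤ n)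
    {b : ℕ} (hb : b ≤ k) :
    PRun k F Y m ⟨s, psum k Y w m, topMax w m n b⟩ n ⟨s, psum k Y w n, b⟩ := by
  induction n, h using Nat.le_induction generalizing b with
  | base =>
    rw [topMax_self]
    exact .refl
  | succ n hmn ih =>
    rw [topMax_succ w hmn, psum_succ]
    exact .step (ih (max_le (hw n) hb)) (.grow s _ (w n) b (hw n) hb)

theorem PRun.idle (hY : ∀ i p, Y i p ≤ k) {i n : ℕ} {q : PState} {s : List (ℕ → ℕ)} {u : ℕ → ℕ}
    (h : PRun k F Y i q n ⟨s, u, 0⟩) {N : ℕ} (hN : n ≤ N) : PRun k F Y i q N ⟨s, u, 0⟩ := by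
  induction N, hN using Nat.le_induction with
  | base => exact h
  | succ N _ ih =>
    have := PStep.grow (F := F) (y := Y N) s u 0 0 (Nat.zero_le k) (Nat.zero_le k)
    rw [raise_zero (hY N), show u ⊔ (0 : ℕ → ℕ) = u by ext p; simp, max_self] at this
    exact .step ih this

theorem PRun.split {i N : ℕ} {q q' : PState} (h : PRun k F Y i q N q') {m : ℕ} (hi : i ≤ m)
    (hm : m < N) : ∃ a b h, PRun k F Y i q m a ∧ PStep k F (Y m) h a b ∧
      PRun k F Y (m + 1) b N q' := by
  induction h with
  | refl => omega
  | @step n h a b hr hs ih =>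
    rcases Nat.lt_succ_iff_lt_or_eq.1 hm with hmn | rfl
    · obtain ⟨a', b', h', h1, h2, h3⟩ := ih hmn
      exact ⟨a', b', h', h1, h2, .step h3 hs⟩
    · exact ⟨a, b, h, hr, hs, .refl⟩

theorem PRun.cur_eq_zero {i n : ℕ} {q q' : PState} (h : PRun k F Y i q n q') {p : ℕ}
    (hp : ∀ m < n, Y m p = 0) (hq : q.cur p = 0) : q'.cur p = 0 := by
  induction h with
  | refl => exact hq
  | @step n h a b hr hs ih =>
    have h1 := ih fun m hm => hp m (by omega)
    have h2 := hp n (by omega)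
    cases hs with
    | grow s u _ j => simpa [raise, Tmap, h2] using h1
    | fresh s u _ j => simp [raise, Tmap, h2]

theorem PStep.cur_apply {y : ℕ → ℕ} {h : ℕ} {q q' : PState} (hs : PStep k F y h q q') {p : ℕ}
    (hp : y p = k) (hq : q.cur p = 0) : q'.cur p = h := by
  cases hs with
  | grow s u _ j hh =>
    simp only at hq
    simp only [raise, Tmap, Pi.sup_apply]
    omega
  | fresh s u _ j hh =>
    simp only [raise, Tmap]
    omega

theorem PRun.exists_mem {m i n h : ℕ} {q q' : PState} (hr : PRun k F Y i q n q')
    (hm : ∀ l, i ≤ l → ∀ p, Y m p = k → Y l p = 0)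
    (hq : ∃ v ∈ q.done ++ [q.cur], ∀ p, Y m p = k → v p = h) :
    ∃ v ∈ q'.done ++ [q'.cur], ∀ p, Y m p = k → v p = h := by
  induction hr with
  | refl => exact hq
  | @step n g a b hr hs ih =>
    obtain ⟨v, hv, hvp⟩ := ih
    cases hs with
    | grow s u _ j =>
      rw [List.mem_append, List.mem_singleton] at hv
      rcases hv with hv | rfl
      · exact ⟨v, List.mem_append_left _ hv, hvp⟩
      · refine ⟨_, List.mem_append_right _ (List.mem_singleton.2 rfl), fun p hp => ?_⟩
        rw [← hvp p hp]
        simp [raise, Tmap, hm n hr.le p hp]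
    | fresh s u _ j => exact ⟨v, List.mem_append_left _ hv, hvp⟩

theorem InSubspace.exists_psum_last (hk : 1 ≤ k) (hY : IsBlockSeq k Y) {v : ℕ → ℕ}
    (hv : InSubspace k Y v) :
    ∃ w N, (∀ i, w i ≤ k) ∧ (∃ i ≤ N, w i = k) ∧ w N ≠ 0 ∧ v = psum k Y w (N + 1) := by
  obtain ⟨w, N, hw, ⟨i, hi, hwi⟩, rfl⟩ := hv.exists_psum hk hY
  induction N with
  | zero => omega
  | succ N ih =>
    by_cases h0 : w N = 0
    · have hiN : i < N := by
        rcases Nat.lt_succ_iff_lt_or_eq.1 hi with h | rfl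
        · exact h
        · omega
      have : psum k Y w (N + 1) = psum k Y w N := by
        rw [psum_succ, h0, raise_zero (hY.le N)]
        ext p; simp
      rw [this] at hv ⊢
      exact ih hiN hv
    · exact ⟨w, N, hw, ⟨i, by omega, hwi⟩, h0, rfl⟩

theorem restrictN_succ (Z : ℕ → ℕ → ℕ) (n : ℕ) :
    restrictN Z (n + 1) = restrictN Z n ++ [Z n] := by
  simp [restrictN, List.range_succ]

theorem psum_eq_zero_of_forall (hY : ∀ i p, Y i p ≤ k) {w : ℕ → ℕ} {N : ℕ}
    (h : ∀ i < N, w i = 0) : psum k Y w N = 0 := by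
  ext p
  simp only [psum, Pi.zero_apply]
  rw [← Nat.bot_eq_zero, Finset.sup_eq_bot_iff]
  intro i hi
  have := hY i p
  rw [h i (Finset.mem_range.1 hi), Nat.bot_eq_zero]
  omega

theorem prun_init_of_word {w : ℕ → ℕ} (hw : ∀ i, w i ≤ k) {N : ℕ}
    (hN : ∃ i < N, w i = k) :
    PRun k F Y 0 ⟨[], 0, k⟩ N ⟨[], psum k Y w N, 0⟩ := by
  obtain ⟨i, hi, hwi⟩ := hN
  have := prun_of_word (F := F) (Y := Y) hw [] (Nat.zero_le N) (Nat.zero_le k)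
  rwa [psum_zero, topMax_eq hw (Nat.zero_le k) (Nat.zero_le i) hi hwi] at this

/-- A finite block sequence of `⟨Y⟩` none of whose proper nonempty initial segments lies in `F`
is built by a run. -/
theorem exists_prun (hk : 1 ≤ k) (hY : IsBlockSeq k Y) {Z : ℕ → ℕ → ℕ} (hZ : BlockLE k Z Y)
    (n : ℕ) (hn : ∀ m < n, restrictN Z (m + 1) ∉ F) :
    ∃ w N, (∀ i, w i ≤ k) ∧ w N ≠ 0 ∧ Z n = psum k Y w (N + 1) ∧
      PRun k F Y 0 ⟨[], 0, k⟩ (N + 1) ⟨restrictN Z n, Z n, 0⟩ := by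
  induction n with
  | zero =>
    obtain ⟨w, N, hw, ⟨i, hi, hwi⟩, hN, hv⟩ := (hZ.2 0).exists_psum_last hk hY
    refine ⟨w, N, hw, hN, hv, ?_⟩
    rw [hv]
    exact prun_init_of_word hw ⟨i, by omega, hwi⟩
  | succ n ih =>
    obtain ⟨w, N, hw, hN, hv, hr⟩ := ih fun m hm => hn m (by omega)
    obtain ⟨w', N', hw', ⟨i, hi, hwi⟩, hN', hv'⟩ := (hZ.2 (n + 1)).exists_psum_last hk hY
    refine ⟨w', N', hw', hN', hv', ?_⟩
    have hlt : ∀ l < N' + 1, w' l ≠ 0 → N < l := by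
      intro l hl' hwl
      by_contra hl
      obtain ⟨p, hp⟩ := (hY.1 N).2.2
      obtain ⟨r, hpr⟩ := (hY.1 l).2.2
      have h1 : Z n p ≠ 0 := by
        rw [hv, psum_apply hk hY (Nat.lt_succ_self N) (by omega)]
        omega
      have h2 : Z (n + 1) r ≠ 0 := by
        rw [hv', psum_apply hk hY hl' (by omega)]
        omega
      have h3 := hZ.1.2 n p r h1 h2
      rcases lt_or_eq_of_le (not_lt.1 hl) with h | rfl
      · have := hY.vecLt hk h r p (by omega) (by omega)
        omega
      · have h2 : Z (n + 1) p ≠ 0 := by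
          rw [hv', psum_apply hk hY hl' (by omega)]
          omega
        exact lt_irrefl _ (hZ.1.2 n p p h1 h2)
    have hNN : N < N' := hlt N' (Nat.lt_succ_self _) hN'
    have hzero : ∀ l < N + 1, w' l = 0 := fun l hl => by
      by_contra h
      have := hlt l (by omega) h
      omega
    have hNi : N + 1 ≤ i := hlt i (by omega) (by omega)
    have hstep := PStep.fresh (F := F) (y := Y (N + 1)) (restrictN Z n) (Z n) (w' (N + 1))
      (topMax w' (N + 2) (N' + 1) 0) (hw' _) (topMax_le hw' _ _ (Nat.zero_le k))
      (by
        rw [← topMax_succ_left w' (by omega) 0]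
        exact topMax_eq hw' (Nat.zero_le k) hNi (by omega) hwi)
      (by
        rw [← restrictN_succ]
        exact hn n (Nat.lt_succ_self n))
    have hpsum : psum k Y w' (N + 2) = raise k (w' (N + 1)) (Y (N + 1)) := by
      rw [psum_succ, psum_eq_zero_of_forall hY.le hzero]
      ext p; simp
    rw [← restrictN_succ, ← hpsum] at hstep
    rw [hv']
    exact (PRun.step hr hstep).trans
      (prun_of_word hw' _ (by omega) (Nat.zero_le k))

end Words

/-! ### Fronts without generic members of length one -/

section Long

variable {k : ℕ} {X : ℕ → ℕ → ℕ} {𝒰 : Ultrafilter (ℕ → ℕ)} {F : Set (List (ℕ → ℕ))}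

theorem IsFront.exists_eq_restrictN (hF : IsFront k X F) (hnil : [] ∉ F) {Y : ℕ → ℕ → ℕ}
    {t : List (ℕ → ℕ)} (ht : t ∈ F ∩ Approx k Y) :
    ∃ Z n, BlockLE k Z Y ∧ t = restrictN Z (n + 1) ∧ ∀ m < n, restrictN Z (m + 1) ∉ F := by
  obtain ⟨htF, htY⟩ := ht
  obtain ⟨n, hn⟩ := Set.mem_iUnion.1 htY
  obtain ⟨Z, hZ, rfl⟩ := hn
  rcases n with _ | n
  · exact absurd htF hnil
  · refine ⟨Z, n, hZ, rfl, fun m hm hmF => ?_⟩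
    have hpre : restrictN Z (m + 1) <+: restrictN Z (n + 1) := by
      rw [List.prefix_iff_eq_take]
      simp only [restrictN, List.length_map, List.length_range, ← List.map_take, List.take_range]
      rw [min_eq_left (by omega)]
    have := congrArg List.length (hF.2.2 _ hmF _ htF hpre)
    simp only [restrictN, List.length_map, List.length_range] at this
    omega

theorem singleton_init_mem (k : ℕ) : (⟨[], 0, k⟩ : PState) ∈ initStates k :=
  ⟨k, Set.mem_Iic.2 le_rfl, rfl⟩

theorem preach_init_subset {Y : ℕ → ℕ → ℕ} (n : ℕ) :
    preach k F Y {⟨[], 0, k⟩} n ⊆ preach k F Y (initStates k) n := by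
  rintro q ⟨q₀, rfl, hr⟩
  exact ⟨_, singleton_init_mem k, hr⟩

/-- The colour of a member of `F` first appears at a step where its run uses a nonzero height. -/
theorem IsGenericSeq.exists_letter (hk : 1 ≤ k) (hX : IsBlockSeq k X) (hU : IsGowers k X 𝒰)
    {f : List (ℕ → ℕ) → ℕ} {E : Set PState → Set (List (ℕ → ℕ) → Prop)}
    {B : Set PState → Set (ℕ → ℕ)} {Y : ℕ → ℕ → ℕ} (hY : IsGenericSeq k X 𝒰 F f E B Y)
    {s : List (ℕ → ℕ)} {u : ℕ → ℕ} {N m c : ℕ} (hr : PRun k F Y 0 ⟨[], 0, k⟩ N ⟨s, u, 0⟩)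
    (ht : s ++ [u] ∈ F) (hc : f (s ++ [u]) = c) (hcm : c ∈ forcedColors k 𝒰 F f Y (m + 1))
    (hcm' : c ∉ forcedColors k 𝒰 F f Y m) :
    ∃ h, 1 ≤ h ∧ ∃ v ∈ s ++ [u], ∀ p, Y m p = k → v p = h := by
  have hYb := hY.blockLE.1
  have hr' := hr.idle hYb.le (le_max_left N (m + 1))
  obtain ⟨a, b, h, h1, h2, h3⟩ := hr'.split (Nat.zero_le m) (by omega)
  have ha : a ∈ preach k F Y {⟨[], 0, k⟩} m := ⟨_, rfl, h1⟩
  have hb : b ∈ preach k F Y {⟨[], 0, k⟩} (m + 1) := ⟨_, rfl, h1.step h2⟩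
  have hfb : Forces k 𝒰 (ForcesColor 𝒰 F f c) b := by
    rw [hY.color_iff hcm (preach_init_subset _ hb) h3, forces_zero hk hX hU, forcesColor_iff ht]
    exact hc
  refine ⟨h, ?_, ?_⟩
  · by_contra hh
    obtain rfl : h = 0 := by omega
    exact hcm' ⟨a, ha, (forces_iff_of_pstep_zero hk hX hU (coherent_forcesColor 𝒰 F f c)
      (hYb.le m) h2).2 hfb⟩
  · refine h3.exists_mem (q' := ⟨s, u, 0⟩) (m := m) (fun l hl p hp => ?_)
      ⟨b.cur, by simp, fun p hp => ?_⟩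
    · exact hYb.eq_zero hk (i := m) (by omega) (by omega)
    · refine h2.cur_apply hp (h1.cur_eq_zero (fun l hl => ?_) rfl)
      exact hYb.eq_zero hk (i := m) (by omega) (by omega)

theorem IsGenericSeq.mem_forcedColors (hk : 1 ≤ k) (hX : IsBlockSeq k X) (hU : IsGowers k X 𝒰)
    {f : List (ℕ → ℕ) → ℕ} {Y : ℕ → ℕ → ℕ}
    {s : List (ℕ → ℕ)} {u : ℕ → ℕ} {N : ℕ} (hr : PRun k F Y 0 ⟨[], 0, k⟩ N ⟨s, u, 0⟩)
    (ht : s ++ [u] ∈ F) : f (s ++ [u]) ∈ forcedColors k 𝒰 F f Y N :=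
  ⟨_, ⟨_, rfl, hr⟩, by rw [forces_zero hk hX hU, forcesColor_iff ht]⟩

theorem isComb_pair (hk : 1 ≤ k) (hX : IsBlockSeq k X) {Y Z : ℕ → ℕ → ℕ} (hY : BlockLE k Y X)
    (hZ : BlockLE k Z Y) {n i j a : ℕ} (hi : i < n) (hj : j < n) (hij : i ≠ j) (ha : a ≤ k) :
    IsComb k X (restrictN Z n) [fun p => ∑ l ∈ {i, j}, Tmap (if l = i then a else 0) (Z l) p] := by
  have hZX := hZ.trans hk hX hY
  have hget : ∀ l < n, (restrictN Z n).getD l (fun _ => 0) = Z l := fun l hl => by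
    simp [restrictN, List.getD_eq_getElem?_getD, hl]
  have hle : ∀ l ∈ ({i, j} : Finset ℕ), (if l = i then a else 0) ≤ k := fun l _ => by
    split_ifs <;> omega
  have hz : ∃ l ∈ ({i, j} : Finset ℕ), (if l = i then a else 0) = 0 :=
    ⟨j, by simp, by simp [hij.symm]⟩
  refine ⟨fun _ => {i, j}, fun _ l => if l = i then a else 0, fun m hm => ?_, fun m hm m' hm' h => ?_⟩
  · obtain rfl : m = 0 := by simpa using hm
    refine ⟨⟨i, by simp⟩, fun l hl => ?_, hle, hz, ?_, ?_⟩
    · simp only [Finset.mem_insert, Finset.mem_singleton] at hl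
      simp only [restrictN, List.length_map, List.length_range]
      omega
    · simp only [List.getD_cons_zero]
      ext p
      refine Finset.sum_congr rfl fun l hl => ?_
      simp only [Finset.mem_insert, Finset.mem_singleton] at hl
      rw [hget l (by omega)]
    · simp only [List.getD_cons_zero]
      exact InSubspace.mono hk hX hZX
        ⟨{i, j}, fun l => if l = i then a else 0, Set.subset_univ _, ⟨i, by simp⟩, hle, hz, rfl⟩
  · simp only [List.length_singleton] at hm hm'
    omega

theorem exists_canonical_of_eventually_notMem (hk : 1 ≤ k) (hX : IsBlockSeq k X)
    (hU : IsGowers k X 𝒰) (hF : IsFront k X F) (hnil : [] ∉ F)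
    (h1 : ∀ᶠ x in (𝒰 : Filter (ℕ → ℕ)), [x] ∉ F) (f : List (ℕ → ℕ) → ℕ) :
    ∃ Y₀, BlockLE k Y₀ X ∧ ∃ φ : List (ℕ → ℕ) → List (ℕ → ℕ),
      (∀ t ∈ F ∩ Approx k Y₀, ∃ c : List (ℕ → ℕ), IsComb k X t c ∧ ListInner (φ t) c) ∧
      ∀ s ∈ F ∩ Approx k Y₀, ∀ t ∈ F ∩ Approx k Y₀, (f s = f t ↔ φ s = φ t) := by
  obtain ⟨Y, hY⟩ := exists_isGenericSeq (F := F) hk hX hU f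
    (fun _ => {fun l => l.length = 1 ∧ l ∈ F}) (fun _ _ => Set.finite_singleton _)
    (by
      rintro - P rfl s hs hsF
      simp only [hsF, and_false, false_iff]
      refine fun h => ?_
      obtain ⟨x, hx, -⟩ := h.exists
      exact hs (by simpa using hx))
    (fun _ => Set.univ) (fun _ _ => Filter.univ_mem)
  have hYX := hY.blockLE
  have hYb := hYX.1
  have hsing : ∀ v, InSubspace k Y v → [v] ∉ F := by
    intro v hv hvF
    obtain ⟨w, N, hw, hN, rfl⟩ := hv.exists_psum hk hYb
    have hr := prun_init_of_word (F := F) (Y := Y) hw hN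
    have := (hY.prop_iff (P := fun l => l.length = 1 ∧ l ∈ F) rfl
      ⟨_, singleton_init_mem k, .refl⟩ hr).2 ((forces_zero hk hX hU _ _ _).2 ⟨rfl, hvF⟩)
    obtain ⟨x, hx, hx'⟩ := (this.and h1).exists
    refine hx' ?_
    have h0 : (0 : ℕ → ℕ) ⊔ raise k k x = x := by
      rw [raise_self]
      ext p; simp
    have h2 := hx.2
    simp only [h0] at h2
    exact h2
  refine ⟨Y, hYX, exists_canonical_of_labels hk f hYX (forcedColors k 𝒰 F f Y)
    (forcedColors_zero_subsingleton 𝒰 f) (forcedColors_finite 𝒰 f) hY.encard_le ?_ ?_⟩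
  · intro t ht
    obtain ⟨Z, n, hZ, rfl, hn⟩ := hF.exists_eq_restrictN hnil ht
    obtain ⟨w, N, hw, -, -, hr⟩ := exists_prun hk hYb hZ n hn
    refine ⟨N + 1, ?_⟩
    rw [restrictN_succ]
    exact IsGenericSeq.mem_forcedColors hk hX hU hr (restrictN_succ Z n ▸ ht.1)
  · intro c m hc hc'
    refine ⟨1, le_rfl, fun t ht htc => ?_⟩
    obtain ⟨Z, n, hZ, rfl, hn⟩ := hF.exists_eq_restrictN hnil ht
    obtain ⟨w, N, hw, -, -, hr⟩ := exists_prun hk hYb hZ n hn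
    obtain ⟨h, hh, v, hv, hvp⟩ := hY.exists_letter hk hX hU hr (restrictN_succ Z n ▸ ht.1)
      (restrictN_succ Z n ▸ htc) hc hc'
    rw [← restrictN_succ] at hv
    obtain ⟨i, hi, rfl⟩ := List.mem_map.1 hv
    rw [List.mem_range] at hi
    have hn0 : n ≠ 0 := by
      rintro rfl
      exact hsing (Z 0) (hZ.2 0) ht.1
    obtain ⟨j, hj, hij⟩ : ∃ j < n + 1, i ≠ j := by
      by_cases h0 : i = 0
      · exact ⟨1, by omega, by omega⟩
      · exact ⟨0, by omega, h0⟩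
    have hhk : h ≤ k := by
      obtain ⟨p, hp⟩ := (hYb.1 m).2.2
      rw [← hvp p hp]
      exact hZ.1.le i p
    refine ⟨_, isComb_pair hk hX hYX hZ hi hj hij (a := h - 1) (by omega), fun p hp => ?_⟩
    have hip := hvp p hp
    have hjp : Z j p = 0 := hZ.1.eq_zero hk hij (by omega)
    simp only [Finset.sum_pair hij, if_true, if_neg hij.symm, Tmap, hip, hjp]
    omega

end Long

/-! ### Limits of colours -/

section Limit

variable {k : ℕ} {X : ℕ → ℕ → ℕ} {𝒰 : Ultrafilter (ℕ → ℕ)} {f : List (ℕ → ℕ) → ℕ}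

/-- The limit of the colours of the extensions of `u` by a generic vector of height `j`. -/
noncomputable def colorLimit (k : ℕ) (𝒰 : Ultrafilter (ℕ → ℕ)) (f : List (ℕ → ℕ) → ℕ)
    (u : ℕ → ℕ) (j : ℕ) : Ultrafilter ℕ :=
  𝒰.map fun x => f [u ⊔ raise k j x]

/-- Adding a generic vector of height `h` to `u` does not change the limit of the colours. -/
def AbsorbsGeneric (k : ℕ) (𝒰 : Ultrafilter (ℕ → ℕ)) (f : List (ℕ → ℕ) → ℕ) (h j : ℕ) (u : ℕ → ℕ) :
    Prop :=
  ∀ᶠ x in (𝒰 : Filter (ℕ → ℕ)), colorLimit k 𝒰 f (u ⊔ raise k h x) j = colorLimit k 𝒰 f u j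

/-- Generic vectors of height `a` absorb generic vectors of height `h`. -/
def TypeAbsorbs (k : ℕ) (𝒰 : Ultrafilter (ℕ → ℕ)) (f : List (ℕ → ℕ) → ℕ) (a h j : ℕ) : Prop :=
  ∀ᶠ x in (𝒰 : Filter (ℕ → ℕ)), AbsorbsGeneric k 𝒰 f h j (raise k a x)

theorem raise_tmap_sub {q : ℕ} (a : ℕ) (hq : q ≤ k) {x : ℕ → ℕ} (hx : ∀ p, x p ≤ k) :
    raise k q (Tmap a x) = raise k (q - a) x := by
  ext p
  have := hx p
  simp only [raise, Tmap]
  omega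

theorem sup_raise_zero (u : ℕ → ℕ) {x : ℕ → ℕ} (hx : ∀ p, x p ≤ k) : u ⊔ raise k 0 x = u := by
  rw [raise_zero hx]
  ext p; simp

theorem IsGowers.joint_left (hk : 1 ≤ k) (hX : IsBlockSeq k X) (hU : IsGowers k X 𝒰) {p q : ℕ}
    (a : ℕ) (hp : p ≤ k) (hq : q ≤ k) {R : (ℕ → ℕ) → (ℕ → ℕ) → Prop}
    (h : ∀ᶠ x in (𝒰 : Filter (ℕ → ℕ)), R (raise k p x) (raise k q x)) :
    ∀ᶠ x in (𝒰 : Filter (ℕ → ℕ)), ∀ᶠ z in (𝒰 : Filter (ℕ → ℕ)),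
      R (raise k (p - a) x ⊔ raise k p z) (raise k (q - a) x ⊔ raise k q z) := by
  rw [hU.left a] at h
  filter_upwards [h, hU.eventually_le hk hX] with x hx hxk
  filter_upwards [hx] with z hz
  rw [← raise_tmap_sub a hp hxk, ← raise_tmap_sub a hq hxk]
  rwa [raise, raise, tmap_sup, tmap_sup] at hz

theorem IsGowers.joint_right (hk : 1 ≤ k) (hX : IsBlockSeq k X) (hU : IsGowers k X 𝒰) {p q : ℕ}
    (a : ℕ) (hp : p ≤ k) (hq : q ≤ k) {R : (ℕ → ℕ) → (ℕ → ℕ) → Prop}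
    (h : ∀ᶠ x in (𝒰 : Filter (ℕ → ℕ)), R (raise k p x) (raise k q x)) :
    ∀ᶠ x in (𝒰 : Filter (ℕ → ℕ)), ∀ᶠ z in (𝒰 : Filter (ℕ → ℕ)),
      R (raise k p x ⊔ raise k (p - a) z) (raise k q x ⊔ raise k (q - a) z) := by
  rw [hU.right a] at h
  filter_upwards [h] with x hx
  filter_upwards [hx, hU.eventually_le hk hX] with z hz hzk
  rw [← raise_tmap_sub a hp hzk, ← raise_tmap_sub a hq hzk]
  rwa [raise, raise, tmap_sup, tmap_sup] at hz

theorem mem_colorLimit_max (hU : IsGowers k X 𝒰) {h j : ℕ} (hh : h ≤ k) (hj : j ≤ k) (u : ℕ → ℕ)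
    (S : Set ℕ) :
    S ∈ colorLimit k 𝒰 f u (max h j) ↔
      ∀ᶠ x in (𝒰 : Filter (ℕ → ℕ)), S ∈ colorLimit k 𝒰 f (u ⊔ raise k h x) j :=
  hU.merge hh hj u fun v => f [v] ∈ S

theorem colorLimit_max_eq (hU : IsGowers k X 𝒰) {h j h' j' : ℕ} (hh : h ≤ k) (hj : j ≤ k)
    (hh' : h' ≤ k) (hj' : j' ≤ k) {u u' : ℕ → ℕ}
    (H : ∀ᶠ x in (𝒰 : Filter (ℕ → ℕ)),
      colorLimit k 𝒰 f (u ⊔ raise k h x) j = colorLimit k 𝒰 f (u' ⊔ raise k h' x) j') :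
    colorLimit k 𝒰 f u (max h j) = colorLimit k 𝒰 f u' (max h' j') := by
  ext S
  rw [mem_colorLimit_max hU hh hj, mem_colorLimit_max hU hh' hj']
  refine Filter.eventually_congr ?_
  filter_upwards [H] with x hx
  rw [hx]

theorem eq_pure_iff_mem {W : Ultrafilter ℕ} {c : ℕ} : W = pure c ↔ {c} ∈ W := by
  refine ⟨fun h => h ▸ Ultrafilter.mem_pure.2 rfl, fun h => ?_⟩
  obtain ⟨x, hx, hW⟩ := W.eq_pure_of_finite_mem (Set.finite_singleton c) h
  rwa [Set.mem_singleton_iff.1 hx] at hW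

theorem colorLimit_max_eq_pure (hU : IsGowers k X 𝒰) {h j c : ℕ} (hh : h ≤ k) (hj : j ≤ k)
    {u : ℕ → ℕ} : colorLimit k 𝒰 f u (max h j) = pure c ↔
      ∀ᶠ x in (𝒰 : Filter (ℕ → ℕ)), colorLimit k 𝒰 f (u ⊔ raise k h x) j = pure c := by
  simp only [eq_pure_iff_mem]
  exact mem_colorLimit_max hU hh hj u _

theorem absorbs_zero (hk : 1 ≤ k) (hX : IsBlockSeq k X) (hU : IsGowers k X 𝒰) (j : ℕ)
    (u : ℕ → ℕ) : AbsorbsGeneric k 𝒰 f 0 j u := by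
  filter_upwards [hU.eventually_le hk hX] with x hx
  rw [sup_raise_zero u hx]

theorem AbsorbsGeneric.mono (hk : 1 ≤ k) (hX : IsBlockSeq k X) (hU : IsGowers k X 𝒰) {h h' : ℕ}
    {u : ℕ → ℕ} (H : AbsorbsGeneric k 𝒰 f h k u) (hh : h ≤ k) (hh' : h' ≤ h) :
    AbsorbsGeneric k 𝒰 f h' k u := by
  have := hU.joint_left hk hX (h - h') hh hh
    (R := fun x _ => colorLimit k 𝒰 f (u ⊔ x) k = colorLimit k 𝒰 f u k) H
  rw [Nat.sub_sub_self hh'] at this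
  filter_upwards [this] with x hx
  have h1 := colorLimit_max_eq (f := f) hU (h := h) (j := k) (h' := 0) (j' := k)
    (u := u ⊔ raise k h' x) (u' := u) hh le_rfl
    (Nat.zero_le k) le_rfl (by
      filter_upwards [hx, hU.eventually_le hk hX] with z hz hzk
      rw [sup_raise_zero u hzk, ← hz, sup_assoc])
  rwa [max_eq_right hh, max_eq_right (Nat.zero_le k)] at h1

theorem AbsorbsGeneric.absorbs_max_iff (hU : IsGowers k X 𝒰) {b h : ℕ} {u : ℕ → ℕ}
    (H : AbsorbsGeneric k 𝒰 f b k u) (hb : b ≤ k) (hh : h ≤ k) :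
    AbsorbsGeneric k 𝒰 f (max b h) k u ↔
      ∀ᶠ y in (𝒰 : Filter (ℕ → ℕ)), AbsorbsGeneric k 𝒰 f h k (u ⊔ raise k b y) := by
  have h1 := hU.merge hb hh u fun v => colorLimit k 𝒰 f v k = colorLimit k 𝒰 f u k
  refine h1.trans (Filter.eventually_congr ?_)
  filter_upwards [H] with y hy
  rw [AbsorbsGeneric, hy]

/-- Absorbing is not affected by absorbed vectors. -/
theorem AbsorbsGeneric.absorbs_iff (hk : 1 ≤ k) (hX : IsBlockSeq k X) (hU : IsGowers k X 𝒰) {b h : ℕ}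
    {u : ℕ → ℕ} (H : AbsorbsGeneric k 𝒰 f b k u) (hb : b ≤ k) (hh : h ≤ k) :
    AbsorbsGeneric k 𝒰 f h k u ↔
      ∀ᶠ y in (𝒰 : Filter (ℕ → ℕ)), AbsorbsGeneric k 𝒰 f h k (u ⊔ raise k b y) := by
  rw [← H.absorbs_max_iff hU hb hh]
  refine ⟨fun h1 => ?_, fun h1 => h1.mono hk hX hU (max_le hb hh) (le_max_right _ _)⟩
  rcases le_total b h with hbh | hbh
  · rwa [max_eq_right hbh]
  · rwa [max_eq_left hbh]

theorem typeAbsorbs_zero (hk : 1 ≤ k) (hX : IsBlockSeq k X) (hU : IsGowers k X 𝒰) (a j : ℕ) :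
    TypeAbsorbs k 𝒰 f a 0 j :=
  Filter.Eventually.of_forall fun _ => absorbs_zero hk hX hU j _

theorem TypeAbsorbs.mono (hk : 1 ≤ k) (hX : IsBlockSeq k X) (hU : IsGowers k X 𝒰) {a h h' : ℕ}
    (H : TypeAbsorbs k 𝒰 f a h k) (hh : h ≤ k) (hh' : h' ≤ h) : TypeAbsorbs k 𝒰 f a h' k := by
  filter_upwards [H] with x hx
  exact hx.mono hk hX hU hh hh'

theorem TypeAbsorbs.typeAbsorbs_iff (hk : 1 ≤ k) (hX : IsBlockSeq k X) (hU : IsGowers k X 𝒰)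
    {a b h : ℕ} (H : TypeAbsorbs k 𝒰 f a b k) (ha : a ≤ k) (hb : b ≤ k) (hh : h ≤ k) :
    TypeAbsorbs k 𝒰 f (max a b) h k ↔ TypeAbsorbs k 𝒰 f a h k := by
  have h1 := hU.merge ha hb 0 fun v => AbsorbsGeneric k 𝒰 f h k v
  have h0 : ∀ v : ℕ → ℕ, 0 ⊔ v = v := fun v => by ext p; simp
  simp only [h0] at h1
  refine h1.trans (Filter.eventually_congr ?_)
  filter_upwards [H] with x hx
  exact (hx.absorbs_iff hk hX hU hb hh).symm

/-- Two heights that absorb the same generic vectors, and either agree or are absorbed. -/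
def SameType (k : ℕ) (𝒰 : Ultrafilter (ℕ → ℕ)) (f : List (ℕ → ℕ) → ℕ) (a a' : ℕ) : Prop :=
  (∀ h ≤ k, TypeAbsorbs k 𝒰 f a h k ↔ TypeAbsorbs k 𝒰 f a' h k) ∧
    (a = a' ∨ TypeAbsorbs k 𝒰 f a a k ∧ TypeAbsorbs k 𝒰 f a a' k)

theorem SameType.max_max (hk : 1 ≤ k) (hX : IsBlockSeq k X) (hU : IsGowers k X 𝒰) {a a' p q : ℕ}
    (H : SameType k 𝒰 f a a') (ha : a ≤ k) (ha' : a' ≤ k) (hp : p ≤ k) (hq : q ≤ k)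
    (hpq : p = q ∨ TypeAbsorbs k 𝒰 f a p k ∧ TypeAbsorbs k 𝒰 f a q k) :
    SameType k 𝒰 f (max a p) (max a' q) := by
  by_cases hpq' : TypeAbsorbs k 𝒰 f a p k ∧ TypeAbsorbs k 𝒰 f a q k
  · obtain ⟨h1, h2⟩ := hpq'
    have e1 : ∀ h ≤ k, _ := fun h hh => h1.typeAbsorbs_iff hk hX hU ha hp hh
    refine ⟨fun h hh => (e1 h hh).trans ((H.1 h hh).trans
      (((H.1 q hq).1 h2).typeAbsorbs_iff hk hX hU ha' hq hh).symm), ?_⟩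
    by_cases hm : max a p = max a' q
    · exact Or.inl hm
    · right
      have haa : TypeAbsorbs k 𝒰 f a a k ∧ TypeAbsorbs k 𝒰 f a a' k := by
        rcases H.2 with rfl | haa
        · rw [and_self]
          by_cases hap : a ≤ p
          · exact h1.mono hk hX hU hp hap
          · exact h2.mono hk hX hU hq (by omega)
        · exact haa
      rw [e1 _ (max_le ha hp), e1 _ (max_le ha' hq)]
      constructor
      · rcases max_choice a p with h | h <;> rw [h]
        exacts [haa.1, h1]
      · rcases max_choice a' q with h | h <;> rw [h]
        exacts [haa.2, h2]
  · obtain rfl : p = q := hpq.resolve_right hpq'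
    rw [and_self] at hpq'
    have hlt : ∀ b ≤ k, TypeAbsorbs k 𝒰 f a b k → b < p := fun b hb h => by
      by_contra hbp
      exact hpq' (h.mono hk hX hU hb (by omega))
    have hm : max a p = max a' p := by
      rcases H.2 with rfl | ⟨h1, h2⟩
      · rfl
      · have := hlt a ha h1
        have := hlt a' ha' h2
        omega
    rw [hm]
    exact ⟨fun _ _ => Iff.rfl, Or.inl rfl⟩

end Limit

/-! ### Fronts whose generic members have length one -/

section Short

variable {k : ℕ} {X : ℕ → ℕ → ℕ} {𝒰 : Ultrafilter (ℕ → ℕ)} {f : List (ℕ → ℕ) → ℕ}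

/-- A sequence that is generic for the limits of the colours of the elements of its span. -/
structure IsColorGeneric (k : ℕ) (𝒰 : Ultrafilter (ℕ → ℕ)) (f : List (ℕ → ℕ) → ℕ)
    (Y : ℕ → ℕ → ℕ) : Prop where
  le : ∀ i p, Y i p ≤ k
  absorbs_iff : ∀ {w : ℕ → ℕ} {n b h j : ℕ}, (∀ i, w i ≤ k) → b ≤ k → h ≤ k → j ≤ k →
    ((∀ᶠ x in (𝒰 : Filter (ℕ → ℕ)), AbsorbsGeneric k 𝒰 f h j (psum k Y w n ⊔ raise k b x)) ↔
      TypeAbsorbs k 𝒰 f (topMax w 0 n b) h j)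
  eq_of_eq : ∀ {w w' : ℕ → ℕ} {i n j j' : ℕ}, (∀ i, w i ≤ k) → (∀ i, w' i ≤ k) → i ≤ n →
    j ≤ k → j' ≤ k → colorLimit k 𝒰 f (psum k Y w n) j = colorLimit k 𝒰 f (psum k Y w' n) j' →
      colorLimit k 𝒰 f (psum k Y w i) (topMax w i n j) =
        colorLimit k 𝒰 f (psum k Y w' i) (topMax w' i n j')
  eq_iff : ∀ {w w' : ℕ → ℕ} {n h h' j j' : ℕ}, (∀ i, w i ≤ k) → (∀ i, w' i ≤ k) →
    h ≤ k → h' ≤ k → j ≤ k → j' ≤ k →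
      (colorLimit k 𝒰 f (psum k Y w n ⊔ raise k h (Y n)) j =
          colorLimit k 𝒰 f (psum k Y w' n ⊔ raise k h' (Y n)) j' ↔
        ∀ᶠ x in (𝒰 : Filter (ℕ → ℕ)), colorLimit k 𝒰 f (psum k Y w n ⊔ raise k h x) j =
          colorLimit k 𝒰 f (psum k Y w' n ⊔ raise k h' x) j')

namespace IsColorGeneric

variable {Y : ℕ → ℕ → ℕ}

theorem absorbs_psum_iff (hk : 1 ≤ k) (hX : IsBlockSeq k X) (hU : IsGowers k X 𝒰)
    (hY : IsColorGeneric k 𝒰 f Y) {w : ℕ → ℕ} {n h j : ℕ} (hw : ∀ i, w i ≤ k) (hh : h ≤ k)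
    (hj : j ≤ k) :
    AbsorbsGeneric k 𝒰 f h j (psum k Y w n) ↔ TypeAbsorbs k 𝒰 f (topMax w 0 n 0) h j := by
  rw [← hY.absorbs_iff hw (Nat.zero_le k) hh hj, hU.eventually_raise_zero hk hX]

theorem colorLimit_eq_of_absorbs (hk : 1 ≤ k) (hX : IsBlockSeq k X) (hU : IsGowers k X 𝒰)
    (hY : IsColorGeneric k 𝒰 f Y) {w : ℕ → ℕ} {n h j : ℕ}
    (hw : ∀ i, w i ≤ k) (hh : h ≤ k) (hj : j ≤ k)
    (H : AbsorbsGeneric k 𝒰 f h j (psum k Y w n)) :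
    colorLimit k 𝒰 f (psum k Y w n ⊔ raise k h (Y n)) j = colorLimit k 𝒰 f (psum k Y w n) j := by
  have key := hY.eq_iff (n := n) hw hw hh (Nat.zero_le k) hj hj
  rw [sup_raise_zero _ (hY.le n)] at key
  refine key.2 ?_
  filter_upwards [H, hU.eventually_le hk hX] with x hx hxk
  rw [hx, sup_raise_zero _ hxk]

/-- A state of top height forcing a colour absorbs everything below its promise. -/
theorem typeAbsorbs_top (hU : IsGowers k X 𝒰) (hY : IsColorGeneric k 𝒰 f Y) {w : ℕ → ℕ}
    {n j c : ℕ} (hw : ∀ i, w i ≤ k) (hj : j ≤ k) (ht : topMax w 0 n j = k)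
    (hc : colorLimit k 𝒰 f (psum k Y w n) j = pure c) {h i : ℕ} (hh : h ≤ j) (hi : i ≤ j) :
    TypeAbsorbs k 𝒰 f k h i := by
  have key := hY.absorbs_iff (n := n) hw hj (hh.trans hj) (hi.trans hj)
  rw [ht] at key
  rw [← key]
  have h1 := hc
  rw [← max_eq_left (max_le hh hi), colorLimit_max_eq_pure hU hj ((max_le hh hi).trans hj)] at h1
  have h2 := hc
  rw [← max_eq_left hi, colorLimit_max_eq_pure hU hj (hi.trans hj)] at h2
  filter_upwards [h1, h2] with x hx hx'
  rw [colorLimit_max_eq_pure hU (hh.trans hj) (hi.trans hj)] at hx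
  filter_upwards [hx] with z hz
  rw [hz, hx']

theorem exists_common_promise_of_lt (hk : 1 ≤ k) (hX : IsBlockSeq k X) (hU : IsGowers k X 𝒰)
    (hY : IsColorGeneric k 𝒰 f Y) {w w' : ℕ → ℕ} {n j j' c : ℕ} (hw : ∀ i, w i ≤ k)
    (hw' : ∀ i, w' i ≤ k) (hj' : j' ≤ k) (hjj : j < j')
    (ht : topMax w 0 n j = k) (ht' : topMax w' 0 n j' = k)
    (hc : colorLimit k 𝒰 f (psum k Y w n) j = pure c)
    (hc' : colorLimit k 𝒰 f (psum k Y w' n) j' = pure c) :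
    ∃ i ≤ k, topMax w 0 n i = k ∧ topMax w' 0 n i = k ∧
      colorLimit k 𝒰 f (psum k Y w n) i = pure c ∧
        colorLimit k 𝒰 f (psum k Y w' n) i = pure c := by
  have hjk : j ≤ k := by omega
  have htype := hY.typeAbsorbs_top hU hw' hj' ht' hc' le_rfl hjj.le
  by_cases ha : topMax w' 0 n 0 = k
  · have habs := (hY.absorbs_psum_iff hk hX hU hw' hj' hjk).2 (by rwa [ha])
    refine ⟨j, hjk, ht, ?_, hc, ?_⟩
    · refine le_antisymm (topMax_le hw' _ _ hjk) ?_
      simp only [topMax] at ha ⊢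
      omega
    · rw [← max_eq_left hjj.le, colorLimit_max_eq_pure hU hj' hjk] at hc'
      obtain ⟨x, hx, hx'⟩ := (habs.and hc').exists
      rw [← hx, hx']
  · have ha' : topMax w 0 n 0 = k ∧ j' = k := by
      simp only [topMax] at ha ht ht' ⊢
      omega
    obtain ⟨ha', rfl⟩ := ha'
    have habs := (hY.absorbs_psum_iff hk hX hU hw le_rfl hjk).2 (by rwa [ha'])
    refine ⟨j', le_rfl, ?_, ht', ?_, hc'⟩
    · refine le_antisymm (topMax_le hw _ _ le_rfl) ?_
      simp only [topMax]
      omega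
    · have key := colorLimit_max_eq_pure (f := f) (c := c) (u := psum j' Y w n) hU le_rfl hjk
      rw [max_eq_left hjk] at key
      rw [key]
      filter_upwards [habs] with x hx
      rw [hx, hc]

theorem exists_common_promise (hk : 1 ≤ k) (hX : IsBlockSeq k X) (hU : IsGowers k X 𝒰)
    (hY : IsColorGeneric k 𝒰 f Y) {w w' : ℕ → ℕ} {n j j' c : ℕ} (hw : ∀ i, w i ≤ k)
    (hw' : ∀ i, w' i ≤ k) (hj : j ≤ k) (hj' : j' ≤ k)
    (ht : topMax w 0 n j = k) (ht' : topMax w' 0 n j' = k)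
    (hc : colorLimit k 𝒰 f (psum k Y w n) j = pure c)
    (hc' : colorLimit k 𝒰 f (psum k Y w' n) j' = pure c) :
    ∃ i ≤ k, topMax w 0 n i = k ∧ topMax w' 0 n i = k ∧
      colorLimit k 𝒰 f (psum k Y w n) i = pure c ∧
        colorLimit k 𝒰 f (psum k Y w' n) i = pure c := by
  rcases lt_trichotomy j j' with h | rfl | h
  · exact hY.exists_common_promise_of_lt hk hX hU hw hw' hj' h ht ht' hc hc'
  · exact ⟨j, hj, ht, ht', hc, hc'⟩
  · obtain ⟨i, hi, h1, h2, h3, h4⟩ :=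
      hY.exists_common_promise_of_lt hk hX hU hw' hw hj h ht' ht hc' hc
    exact ⟨i, hi, h2, h1, h4, h3⟩

/-- If the limits agree after the letters `w n` and `w' n < w n`, with promise below the top,
then the shorter letter is absorbed. -/
theorem typeAbsorbs_of_lt (hk : 1 ≤ k) (hX : IsBlockSeq k X) (hU : IsGowers k X 𝒰)
    (hY : IsColorGeneric k 𝒰 f Y) {w w' : ℕ → ℕ} {n j : ℕ} (hw : ∀ i, w i ≤ k)
    (hw' : ∀ i, w' i ≤ k) (hj : j ≤ k) (hlt : w' n < w n)
    (ht : topMax w 0 (n + 1) 0 = k) (ht' : topMax w' 0 n 0 = k)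
    (heq : colorLimit k 𝒰 f (psum k Y w (n + 1)) j = colorLimit k 𝒰 f (psum k Y w' (n + 1)) j) :
    ∀ h ≤ w n, TypeAbsorbs k 𝒰 f k h j := by
  rw [psum_succ, psum_succ, hY.eq_iff hw hw' (hw n) (hw' n) hj hj] at heq
  rw [topMax_succ w (Nat.zero_le n), Nat.max_zero] at ht
  intro h
  induction h using Nat.strong_induction_on with
  | _ h ih =>
    intro hh
    rcases Nat.eq_zero_or_pos h with rfl | hpos
    · exact typeAbsorbs_zero hk hX hU k j
    have h1 := hU.joint_right hk hX (w n - h) (hw n) (hw' n)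
      (R := fun x y => colorLimit k 𝒰 f (psum k Y w n ⊔ x) j =
        colorLimit k 𝒰 f (psum k Y w' n ⊔ y) j) heq
    rw [Nat.sub_sub_self hh] at h1
    have h2 := ih (w' n - (w n - h)) (by omega) (by omega)
    have ht'' : topMax w' 0 n (w' n) = k := by
      refine le_antisymm (topMax_le hw' _ _ (hw' n)) ?_
      simp only [topMax] at ht' ⊢
      omega
    have key := hY.absorbs_iff (n := n) (h := h) hw (hw n) (hh.trans (hw n)) hj
    have key' := hY.absorbs_iff (n := n) (h := w' n - (w n - h)) hw' (hw' n)
      (by have := hw' n; omega) hj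
    rw [ht] at key
    rw [ht''] at key'
    rw [← key'] at h2
    rw [← key]
    filter_upwards [h1, h2, heq] with x h1x h2x hx
    filter_upwards [h1x, h2x] with z h1z h2z
    rw [sup_assoc, h1z, ← sup_assoc, h2z, hx]

/-- If the limits agree before and after the letters `w n` and `w' n < w n`, with top promise,
then the letter `w n` is absorbed. -/
theorem absorbs_of_lt (hk : 1 ≤ k) (hX : IsBlockSeq k X) (hU : IsGowers k X 𝒰)
    (hY : IsColorGeneric k 𝒰 f Y) {w w' : ℕ → ℕ} {n : ℕ} (hw : ∀ i, w i ≤ k)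
    (hw' : ∀ i, w' i ≤ k) (hlt : w' n < w n)
    (hT : ∀ h ≤ k, TypeAbsorbs k 𝒰 f (topMax w 0 n 0) h k ↔
      TypeAbsorbs k 𝒰 f (topMax w' 0 n 0) h k)
    (heq₀ : colorLimit k 𝒰 f (psum k Y w n) k = colorLimit k 𝒰 f (psum k Y w' n) k)
    (heq : colorLimit k 𝒰 f (psum k Y w (n + 1)) k = colorLimit k 𝒰 f (psum k Y w' (n + 1)) k) :
    TypeAbsorbs k 𝒰 f (topMax w 0 n 0) (w n) k := by
  rw [psum_succ, psum_succ, hY.eq_iff hw hw' (hw n) (hw' n) le_rfl le_rfl] at heq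
  suffices H : ∀ h ≤ w n, TypeAbsorbs k 𝒰 f (topMax w 0 n 0) h k from H _ le_rfl
  intro h
  induction h using Nat.strong_induction_on with
  | _ h ih =>
    intro hh
    rcases Nat.eq_zero_or_pos h with rfl | hpos
    · exact typeAbsorbs_zero hk hX hU _ k
    have h1 := hU.joint_left hk hX (w n - h) (hw n) (hw' n)
      (R := fun x y => colorLimit k 𝒰 f (psum k Y w n ⊔ x) k =
        colorLimit k 𝒰 f (psum k Y w' n ⊔ y) k) heq
    rw [Nat.sub_sub_self hh] at h1
    have hle : w' n - (w n - h) ≤ k := by have := hw' n; omega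
    have h2 := ih (w' n - (w n - h)) (by omega) (by omega)
    rw [hT _ hle, ← hY.absorbs_psum_iff hk hX hU hw' hle le_rfl] at h2
    rw [← hY.absorbs_psum_iff hk hX hU hw (hh.trans (hw n)) le_rfl]
    filter_upwards [h1, h2] with x h1x h2x
    have h3 := colorLimit_max_eq (f := f) hU (hw n) le_rfl (hw' n) le_rfl
      (u := psum k Y w n ⊔ raise k h x) (u' := psum k Y w' n ⊔ raise k (w' n - (w n - h)) x) (by
        filter_upwards [h1x] with z hz
        rw [sup_assoc, hz, sup_assoc])
    rw [max_eq_right (hw n), max_eq_right (hw' n)] at h3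
    rw [h3, h2x, heq₀]

theorem absorbs_of_ne (hk : 1 ≤ k) (hX : IsBlockSeq k X) (hU : IsGowers k X 𝒰)
    (hY : IsColorGeneric k 𝒰 f Y) {w w' : ℕ → ℕ} {n : ℕ} (hw : ∀ i, w i ≤ k)
    (hw' : ∀ i, w' i ≤ k) (hne : w n ≠ w' n)
    (hT : ∀ h ≤ k, TypeAbsorbs k 𝒰 f (topMax w 0 n 0) h k ↔
      TypeAbsorbs k 𝒰 f (topMax w' 0 n 0) h k)
    (heq₀ : colorLimit k 𝒰 f (psum k Y w n) k = colorLimit k 𝒰 f (psum k Y w' n) k)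
    (heq : colorLimit k 𝒰 f (psum k Y w (n + 1)) k = colorLimit k 𝒰 f (psum k Y w' (n + 1)) k) :
    TypeAbsorbs k 𝒰 f (topMax w 0 n 0) (w n) k ∧ TypeAbsorbs k 𝒰 f (topMax w 0 n 0) (w' n) k := by
  rcases hne.lt_or_gt with hlt | hlt
  · have := hY.absorbs_of_lt hk hX hU hw' hw hlt (fun h hh => (hT h hh).symm) heq₀.symm heq.symm
    rw [← hT _ (hw' n)] at this
    exact ⟨this.mono hk hX hU (hw' n) hlt.le, this⟩
  · have := hY.absorbs_of_lt hk hX hU hw hw' hlt hT heq₀ heq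
    exact ⟨this, this.mono hk hX hU (hw n) hlt.le⟩

theorem sameType_topMax (hk : 1 ≤ k) (hX : IsBlockSeq k X) (hU : IsGowers k X 𝒰)
    (hY : IsColorGeneric k 𝒰 f Y) {w w' : ℕ → ℕ} {n : ℕ} (hw : ∀ i, w i ≤ k)
    (hw' : ∀ i, w' i ≤ k)
    (heq : ∀ i ≤ n, colorLimit k 𝒰 f (psum k Y w i) k = colorLimit k 𝒰 f (psum k Y w' i) k) :
    SameType k 𝒰 f (topMax w 0 n 0) (topMax w' 0 n 0) := by
  induction n with
  | zero => exact ⟨fun _ _ => Iff.rfl, Or.inl rfl⟩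
  | succ n ih =>
    have hs := ih fun i hi => heq i (by omega)
    have h0 : ∀ w : ℕ → ℕ, topMax w 0 (n + 1) 0 = max (topMax w 0 n 0) (w n) := fun w => by
      rw [topMax_succ w (Nat.zero_le n)]
      simp only [topMax]
      omega
    rw [h0, h0]
    refine hs.max_max hk hX hU (topMax_le hw _ _ (Nat.zero_le k)) (topMax_le hw' _ _ (Nat.zero_le k))
      (hw n) (hw' n) ?_
    by_cases hne : w n = w' n
    · exact Or.inl hne
    · exact Or.inr (hY.absorbs_of_ne hk hX hU hw hw' hne hs.1 (heq n (by omega)) (heq _ le_rfl))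

/-- At the first level where a colour is forced, the letter is determined by the colour. -/
theorem letter_unique (hk : 1 ≤ k) (hX : IsBlockSeq k X) (hU : IsGowers k X 𝒰)
    (hY : IsColorGeneric k 𝒰 f Y) {n c : ℕ}
    (hmin : ∀ w : ℕ → ℕ, (∀ i, w i ≤ k) → ∀ j ≤ k, topMax w 0 n j = k →
      colorLimit k 𝒰 f (psum k Y w n) j ≠ pure c)
    {w w' : ℕ → ℕ} {j j' : ℕ} (hw : ∀ i, w i ≤ k) (hw' : ∀ i, w' i ≤ k) (hj : j ≤ k) (hj' : j' ≤ k)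
    (ht : topMax w 0 (n + 1) j = k) (ht' : topMax w' 0 (n + 1) j' = k)
    (hc : colorLimit k 𝒰 f (psum k Y w (n + 1)) j = pure c)
    (hc' : colorLimit k 𝒰 f (psum k Y w' (n + 1)) j' = pure c) : w n = w' n := by
  obtain ⟨i, hi, ht, ht', hc, hc'⟩ := hY.exists_common_promise hk hX hU hw hw' hj hj' ht ht' hc hc'
  wlog hlt : w' n < w n generalizing w w' j j'
  · by_contra hne
    exact hne (this hw' hw hi hi ‹_› ‹_› ‹_› ‹_› ht' ht hc' hc (by omega)).symm
  exfalso
  rcases hi.lt_or_eq with hik | rfl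
  · have hle := hw n
    have e1 : topMax w 0 (n + 1) 0 = k := by
      simp only [topMax] at ht ⊢
      omega
    have e2 : topMax w' 0 n 0 = k := by
      rw [topMax_succ w' (Nat.zero_le n)] at ht'
      simp only [topMax] at ht' ⊢
      omega
    have h1 := hY.typeAbsorbs_of_lt hk hX hU hw hw' hi hlt e1 e2 (hc.trans hc'.symm) _ hlt.le
    have key := hY.absorbs_psum_iff (n := n) hk hX hU hw' (hw' n) hi
    rw [e2] at key
    rw [← key] at h1
    refine hmin w' hw' i hi ?_ ?_
    · refine le_antisymm (topMax_le hw' _ _ hi) ?_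
      simp only [topMax] at e2 ⊢
      omega
    · rw [← hY.colorLimit_eq_of_absorbs hk hX hU hw' (hw' n) hi h1, ← psum_succ, hc']
  · have htop : ∀ (w : ℕ → ℕ), (∀ l, w l ≤ i) → ∀ m, topMax w m (n + 1) i = i := fun w hw m =>
      le_antisymm (topMax_le hw _ _ le_rfl) (le_max_right _ _)
    have heq : ∀ m ≤ n + 1,
        colorLimit i 𝒰 f (psum i Y w m) i = colorLimit i 𝒰 f (psum i Y w' m) i := fun m hm => by
      have := hY.eq_of_eq hw hw' hm le_rfl le_rfl (hc.trans hc'.symm)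
      rwa [htop w hw, htop w' hw'] at this
    have hs := hY.sameType_topMax hk hX hU hw hw' (n := n) fun m hm => heq m (by omega)
    have h1 := (hY.absorbs_of_ne hk hX hU hw hw' hlt.ne' hs.1 (heq n (by omega))
      (heq _ le_rfl)).1
    rw [← hY.absorbs_psum_iff hk hX hU hw (hw n) le_rfl] at h1
    refine hmin w hw i le_rfl (le_antisymm (topMax_le hw _ _ le_rfl) (le_max_right _ _)) ?_
    rw [← hY.colorLimit_eq_of_absorbs hk hX hU hw (hw n) le_rfl h1, ← psum_succ, hc]

end IsColorGeneric

end Short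

section Short

variable {k : ℕ} {X : ℕ → ℕ → ℕ} {𝒰 : Ultrafilter (ℕ → ℕ)} {F : Set (List (ℕ → ℕ))}

theorem exists_separator (k : ℕ) (𝒰 : Ultrafilter (ℕ → ℕ)) (f : List (ℕ → ℕ) → ℕ) :
    ∃ S : PState → PState → Set ℕ, ∀ q q',
      (S q q' ∈ colorLimit k 𝒰 f q.cur q.prom ↔ S q q' ∈ colorLimit k 𝒰 f q'.cur q'.prom) →
        colorLimit k 𝒰 f q.cur q.prom = colorLimit k 𝒰 f q'.cur q'.prom := by
  have : ∀ q q' : PState, ∃ S : Set ℕ,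
      (S ∈ colorLimit k 𝒰 f q.cur q.prom ↔ S ∈ colorLimit k 𝒰 f q'.cur q'.prom) →
        colorLimit k 𝒰 f q.cur q.prom = colorLimit k 𝒰 f q'.cur q'.prom := by
    intro q q'
    by_contra h
    push Not at h
    exact (h ∅).2 (Ultrafilter.ext fun S => (h S).1)
  choose S hS using this
  exact ⟨S, hS⟩

theorem psum_state_mem_preach {Y : ℕ → ℕ → ℕ} {w : ℕ → ℕ} (hw : ∀ i, w i ≤ k) (n : ℕ) {b : ℕ}
    (hb : b ≤ k) : (⟨[], psum k Y w n, b⟩ : PState) ∈ preach k F Y (initStates k) n := by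
  refine ⟨_, ⟨topMax w 0 n b, topMax_le hw _ _ hb, rfl⟩, ?_⟩
  have := prun_of_word (F := F) (Y := Y) hw [] (Nat.zero_le n) hb
  rwa [psum_zero] at this

/-- The properties for which a sequence has to be generic in order to analyse the colours of
the elements of its span. -/
def colorProps (k : ℕ) (𝒰 : Ultrafilter (ℕ → ℕ)) (f : List (ℕ → ℕ) → ℕ)
    (F : Set (List (ℕ → ℕ))) (S : PState → PState → Set ℕ) (Q : Set PState) :
    Set (List (ℕ → ℕ) → Prop) :=
  {fun l => l ∈ F} ∪
    ((fun (z : ℕ × ℕ) l => AbsorbsGeneric k 𝒰 f z.1 z.2 (l.headD 0)) '' (Set.Iic k ×ˢ Set.Iic k) ∪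
      (fun (z : PState × PState) l => f l ∈ S z.1 z.2) '' (Q ×ˢ Q))

/-- The vectors that behave generically with respect to the equality of limits of colours. -/
def colorGenericSet (k : ℕ) (𝒰 : Ultrafilter (ℕ → ℕ)) (f : List (ℕ → ℕ) → ℕ) (Q : Set PState) :
    Set (ℕ → ℕ) :=
  {y | ∀ q ∈ Q, ∀ q' ∈ Q, ∀ h ∈ Set.Iic k, ∀ h' ∈ Set.Iic k, ∀ j ∈ Set.Iic k, ∀ j' ∈ Set.Iic k,
    (colorLimit k 𝒰 f (q.cur ⊔ raise k h y) j = colorLimit k 𝒰 f (q'.cur ⊔ raise k h' y) j' ↔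
      ∀ᶠ x in (𝒰 : Filter (ℕ → ℕ)),
        colorLimit k 𝒰 f (q.cur ⊔ raise k h x) j = colorLimit k 𝒰 f (q'.cur ⊔ raise k h' x) j')}

theorem colorGenericSet_mem (f : List (ℕ → ℕ) → ℕ) {Q : Set PState} (hQ : Q.Finite) :
    colorGenericSet k 𝒰 f Q ∈ 𝒰 := by
  have hk := Set.finite_Iic k
  refine (Filter.eventually_all_finite hQ).2 fun q _ => ?_
  refine (Filter.eventually_all_finite hQ).2 fun q' _ => ?_
  refine (Filter.eventually_all_finite hk).2 fun h _ => ?_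
  refine (Filter.eventually_all_finite hk).2 fun h' _ => ?_
  refine (Filter.eventually_all_finite hk).2 fun j _ => ?_
  refine (Filter.eventually_all_finite hk).2 fun j' _ => ?_
  filter_upwards [Ultrafilter.eventually_iff_const (Iff.rfl : (∀ᶠ x in (𝒰 : Filter (ℕ → ℕ)),
    colorLimit k 𝒰 f (q.cur ⊔ raise k h x) j = colorLimit k 𝒰 f (q'.cur ⊔ raise k h' x) j') ↔ _)]
    with y hy
  exact hy.symm

theorem IsGenericSeq.isColorGeneric {f : List (ℕ → ℕ) → ℕ} {S : PState → PState → Set ℕ} (hS : ∀ q q',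
      (S q q' ∈ colorLimit k 𝒰 f q.cur q.prom ↔ S q q' ∈ colorLimit k 𝒰 f q'.cur q'.prom) →
        colorLimit k 𝒰 f q.cur q.prom = colorLimit k 𝒰 f q'.cur q'.prom)
    {Y : ℕ → ℕ → ℕ} (hY : IsGenericSeq k X 𝒰 Set.univ f (colorProps k 𝒰 f F S)
      (colorGenericSet k 𝒰 f) Y) : IsColorGeneric k 𝒰 f Y where
  le := hY.blockLE.1.le
  absorbs_iff {w n b h j} hw hb hh hj := by
    have hr := prun_of_word (F := Set.univ) (Y := Y) hw [] (Nat.zero_le n) hb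
    have h1 := hY.prop_iff (P := fun l => AbsorbsGeneric k 𝒰 f h j (l.headD 0))
      (Or.inr (Or.inl ⟨(h, j), ⟨hh, hj⟩, rfl⟩))
      (psum_state_mem_preach hw 0 (topMax_le hw 0 n hb)) hr
    refine h1.symm.trans ?_
    have h0 : ∀ v : ℕ → ℕ, psum k Y w 0 ⊔ v = v := fun v => by
      rw [psum_zero]
      ext p; simp
    simp only [Forces, h0]
    rfl
  eq_of_eq {w w' i n j j'} hw hw' hin hj hj' heq := by
    have hq := psum_state_mem_preach (F := Set.univ) (Y := Y) hw i (topMax_le hw i n hj)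
    have hq' := psum_state_mem_preach (F := Set.univ) (Y := Y) hw' i (topMax_le hw' i n hj')
    refine hS ⟨[], psum k Y w i, topMax w i n j⟩ ⟨[], psum k Y w' i, topMax w' i n j'⟩ ?_
    have hP : (fun l => f l ∈ S ⟨[], psum k Y w i, topMax w i n j⟩
        ⟨[], psum k Y w' i, topMax w' i n j'⟩) ∈
          colorProps k 𝒰 f F S (preach k Set.univ Y (initStates k) i) :=
      Or.inr (Or.inr ⟨(_, _), ⟨hq, hq'⟩, rfl⟩)
    have h1 := hY.prop_iff hP hq (prun_of_word hw [] hin hj)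
    have h2 := hY.prop_iff hP hq' (prun_of_word hw' [] hin hj')
    refine h1.trans (Iff.trans ?_ h2.symm)
    change _ ∈ colorLimit k 𝒰 f (psum k Y w n) j ↔ _ ∈ colorLimit k 𝒰 f (psum k Y w' n) j'
    rw [heq]
  eq_iff {w w' n h h' j j'} hw hw' hh hh' hj hj' :=
    hY.mem n _ (psum_state_mem_preach hw n (Nat.zero_le k)) _
      (psum_state_mem_preach hw' n (Nat.zero_le k)) h hh h' hh' j hj j' hj'

theorem isComb_singleton {v : ℕ → ℕ} (hv : InSubspace k X v) : IsComb k X [v] [v] := by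
  refine ⟨fun _ => {0}, fun _ _ => 0, fun m hm => ?_, fun m hm m' hm' h => ?_⟩
  · obtain rfl : m = 0 := by simpa using hm
    exact ⟨by simp, by simp, by simp, by simp, by ext p; simp [Tmap], by simpa using hv⟩
  · simp only [List.length_singleton] at hm hm'
    omega

theorem forces_forcesColor_univ {f : List (ℕ → ℕ) → ℕ} {c j : ℕ} {u : ℕ → ℕ} :
    Forces k 𝒰 (ForcesColor 𝒰 Set.univ f c) ⟨[], u, j⟩ ↔ colorLimit k 𝒰 f u j = pure c := by
  rw [eq_pure_iff_mem]
  refine Filter.eventually_congr (Filter.Eventually.of_forall fun x => ?_)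
  exact forcesColor_iff (Set.mem_univ _)

theorem exists_canonical_of_eventually_mem (hk : 1 ≤ k) (hX : IsBlockSeq k X)
    (hU : IsGowers k X 𝒰) (hF : IsFront k X F) (hnil : [] ∉ F)
    (h1 : ∀ᶠ x in (𝒰 : Filter (ℕ → ℕ)), [x] ∈ F) (f : List (ℕ → ℕ) → ℕ) :
    ∃ Y₀, BlockLE k Y₀ X ∧ ∃ φ : List (ℕ → ℕ) → List (ℕ → ℕ),
      (∀ t ∈ F ∩ Approx k Y₀, ∃ c : List (ℕ → ℕ), IsComb k X t c ∧ ListInner (φ t) c) ∧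
      ∀ s ∈ F ∩ Approx k Y₀, ∀ t ∈ F ∩ Approx k Y₀, (f s = f t ↔ φ s = φ t) := by
  obtain ⟨S, hS⟩ := exists_separator k 𝒰 f
  obtain ⟨Y, hY⟩ := exists_isGenericSeq (F := Set.univ) hk hX hU f (colorProps k 𝒰 f F S)
    (fun Q hQ => (Set.finite_singleton _).union
      ((((Set.finite_Iic k).prod (Set.finite_Iic k)).image _).union ((hQ.prod hQ).image _)))
    (fun _ _ _ s _ hs => absurd (Set.mem_univ s) hs) (colorGenericSet k 𝒰 f)
    (fun Q hQ => colorGenericSet_mem f hQ)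
  have hG := hY.isColorGeneric hS
  have hYX := hY.blockLE
  have hYb := hYX.1
  have hsing : ∀ v, InSubspace k Y v → [v] ∈ F := by
    intro v hv
    obtain ⟨w, N, hw, hN, rfl⟩ := hv.exists_psum hk hYb
    have hr := prun_init_of_word (F := Set.univ) (Y := Y) hw hN
    refine (forces_zero hk hX hU (fun l => l ∈ F) [] _).1 ((hY.prop_iff (P := fun l => l ∈ F)
      (Or.inl rfl) ⟨_, singleton_init_mem k, .refl⟩ hr).1 ?_)
    have h0 : ∀ v : ℕ → ℕ, 0 ⊔ v = v := fun v => by ext p; simp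
    simp only [Forces, h0, raise_self]
    exact h1
  have hshape : ∀ t ∈ F ∩ Approx k Y, ∃ w N, (∀ i, w i ≤ k) ∧ (∃ i < N, w i = k) ∧
      t = [psum k Y w N] ∧ InSubspace k Y (psum k Y w N) := by
    intro t ht
    obtain ⟨Z, n, hZ, rfl, hn⟩ := hF.exists_eq_restrictN hnil ht
    obtain rfl : n = 0 := by
      by_contra h0
      exact hn 0 (by omega) (hsing (Z 0) (hZ.2 0))
    obtain ⟨w, N, hw, hN, hv⟩ := (hZ.2 0).exists_psum hk hYb
    exact ⟨w, N, hw, hN, by rw [← hv]; rfl, hv ▸ hZ.2 0⟩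
  refine ⟨Y, hYX, exists_canonical_of_labels hk f hYX (forcedColors k 𝒰 Set.univ f Y)
    (forcedColors_zero_subsingleton 𝒰 f) (forcedColors_finite 𝒰 f) hY.encard_le ?_ ?_⟩
  · intro t ht
    obtain ⟨w, N, hw, hN, rfl, -⟩ := hshape t ht
    exact ⟨N, IsGenericSeq.mem_forcedColors (s := []) hk hX hU (prun_init_of_word hw hN)
      (Set.mem_univ _)⟩
  · intro c m hc hc'
    have hmin : ∀ w : ℕ → ℕ, (∀ i, w i ≤ k) → ∀ j ≤ k, topMax w 0 m j = k →
        colorLimit k 𝒰 f (psum k Y w m) j ≠ pure c := by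
      intro w hw j hj ht heq
      have hr := prun_of_word (F := Set.univ) (Y := Y) hw [] (Nat.zero_le m) hj
      rw [psum_zero, ht] at hr
      exact hc' ⟨_, ⟨_, rfl, hr⟩, forces_forcesColor_univ.2 heq⟩
    have hmain : ∀ t ∈ F ∩ Approx k Y, f t = c → ∃ w j, (∀ i, w i ≤ k) ∧ j ≤ k ∧
        topMax w 0 (m + 1) j = k ∧ colorLimit k 𝒰 f (psum k Y w (m + 1)) j = pure c ∧
        ∃ v, t = [v] ∧ IsComb k X t [v] ∧ ∀ p, Y m p = k → v p = w m := by
      intro t ht htc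
      obtain ⟨w₀, N₀, hw₀, ⟨i, hi, hwi⟩, rfl, hsub⟩ := hshape t ht
      obtain ⟨w, N, hw, hN, hmN, hpsum⟩ : ∃ w N, (∀ i, w i ≤ k) ∧ (∃ i < N, w i = k) ∧ m < N ∧
          psum k Y w₀ N₀ = psum k Y w N := by
        refine ⟨_, max N₀ (m + 1), fun i => ?_, ⟨i, lt_of_lt_of_le hi (le_max_left _ _), ?_⟩,
          by omega, psum_extend hYb.le w₀ (le_max_left _ _)⟩
        · split_ifs
          exacts [hw₀ i, Nat.zero_le k]
        · rw [if_pos hi, hwi]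
      rw [hpsum] at ht htc hsub ⊢
      have hr := prun_init_of_word (F := Set.univ) (Y := Y) hw hN
      have hr' := prun_of_word (F := Set.univ) (Y := Y) hw [] (Nat.succ_le_of_lt hmN)
        (Nat.zero_le k)
      have hjk := topMax_le hw (m + 1) N (Nat.zero_le k)
      refine ⟨w, topMax w (m + 1) N 0, hw, hjk, ?_, ?_,
        psum k Y w N, rfl, isComb_singleton (hsub.mono hk hX hYX), fun p hp => ?_⟩
      · obtain ⟨i, hi, hwi⟩ := hN
        rcases lt_or_ge i (m + 1) with him | him
        · exact topMax_eq hw hjk (Nat.zero_le i) him hwi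
        · rw [topMax_eq hw (Nat.zero_le k) him hi hwi]
          exact le_antisymm (topMax_le hw _ _ le_rfl) (le_max_right _ _)
      · rw [← forces_forcesColor_univ, hY.color_iff hc (psum_state_mem_preach hw _ hjk) hr',
          forces_zero hk hX hU, forcesColor_iff (Set.mem_univ _)]
        exact htc
      · rw [psum_apply hk hYb hmN (by omega), hp]
        have := hw m
        omega
    by_cases hex : ∃ t ∈ F ∩ Approx k Y, f t = c
    · obtain ⟨t, ht, htc⟩ := hex
      obtain ⟨w, j, hw, hj, htop, hlim, -⟩ := hmain t ht htc
      refine ⟨w m, ?_, fun t' ht' htc' => ?_⟩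
      · by_contra h0
        have h0 : w m = 0 := by omega
        rw [topMax_succ w (Nat.zero_le m), h0, Nat.zero_max] at htop
        rw [psum_succ, h0, sup_raise_zero _ (hYb.le m)] at hlim
        exact hmin w hw j hj htop hlim
      · obtain ⟨w', j', hw', hj', htop', hlim', v, -, hv, hvp⟩ := hmain t' ht' htc'
        refine ⟨v, hv, fun p hp => ?_⟩
        rw [hvp p hp]
        exact hG.letter_unique hk hX hU hmin hw' hw hj' hj htop' htop hlim' hlim
    · exact ⟨1, le_rfl, fun t ht htc => absurd ⟨t, ht, htc⟩ hex⟩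

end Short

/-- A front containing the empty sequence has no other members. -/
theorem exists_canonical_of_nil_mem {k : ℕ} {X : ℕ → ℕ → ℕ} {F : Set (List (ℕ → ℕ))}
    (hX : IsBlockSeq k X) (hF : IsFront k X F) (hnil : [] ∈ F) (f : List (ℕ → ℕ) → ℕ) :
    ∃ Y₀, BlockLE k Y₀ X ∧ ∃ φ : List (ℕ → ℕ) → List (ℕ → ℕ),
      (∀ t ∈ F ∩ Approx k Y₀, ∃ c : List (ℕ → ℕ), IsComb k X t c ∧ ListInner (φ t) c) ∧
      ∀ s ∈ F ∩ Approx k Y₀, ∀ t ∈ F ∩ Approx k Y₀, (f s = f t ↔ φ s = φ t) := by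
  have h : ∀ t ∈ F, t = [] := fun t ht => (hF.2.2 [] hnil t ht List.nil_prefix).symm
  refine ⟨X, BlockLE.refl hX, fun _ => [], fun t _ => ⟨[], ?_, [], List.nil_sublist _, rfl, ?_⟩,
    fun s hs t ht => ?_⟩
  · exact ⟨fun _ => ∅, fun _ _ => 0, fun m hm => absurd hm (Nat.not_lt_zero m),
      fun m hm => absurd hm (Nat.not_lt_zero m)⟩
  · exact fun i hi => absurd hi (Nat.not_lt_zero i)
  · simp [h s hs.1, h t ht.1]

/-- **Main theorem.** Every coloring of a front on `[∅, X]` is canonical on some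
reduct `Y₀ ≤ X`: there is an inner map `φ`, each of whose values is contained
coordinatewise in a tuple of disjoint combinations of the terms of the argument
(elements of `⟨X⟩`), such that two members of `F↾Y₀` get the same `f`-color if
and only if they get the same `φ`-value. -/
theorem statement0 (k : ℕ) (hk : 1 ≤ k) (X : ℕ → ℕ → ℕ) (hX : IsBlockSeq k X)
    (F : Set (List (ℕ → ℕ))) (hF : IsFront k X F) (f : List (ℕ → ℕ) → ℕ) :
    ∃ Y₀, BlockLE k Y₀ X ∧
      ∃ φ : List (ℕ → ℕ) → List (ℕ → ℕ),
        (∀ t ∈ F ∩ Approx k Y₀, ∃ c : List (ℕ → ℕ), IsComb k X t c ∧ ListInner (φ t) c) ∧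
        ∀ s ∈ F ∩ Approx k Y₀, ∀ t ∈ F ∩ Approx k Y₀, (f s = f t ↔ φ s = φ t) := by
  by_cases hnil : [] ∈ F
  · exact exists_canonical_of_nil_mem hX hF hnil f
  · obtain ⟨𝒰, hU⟩ := exists_isGowers hk hX
    by_cases h1 : ∀ᶠ x in (𝒰 : Filter (ℕ → ℕ)), [x] ∈ F
    · exact exists_canonical_of_eventually_mem hk hX hU hF hnil h1 f
    · exact exists_canonical_of_eventually_notMem hk hX hU hF hnil
        (Ultrafilter.eventually_not.2 h1) f
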